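/- If G is a minimal counterexample, then G contains no cycle of length 6. -/

import Mathlib

open SimpleGraph

/-- A `(1,2^k)`-packing edge-coloring encoded as a function assigning a color in
`Fin (k+1)` to each unordered pair. Color `0` is the 1-color (its class must be a
matching) and each color `i ≠ 0` is a 2-color (its class must be an induced matching). -/
def IsPackingEC {V : Type} (G : SimpleGraph V) (k : ℕ)
    (c : Sym2 V → Fin (k + 1)) : Prop :=
  (∀ a b x y : V, G.Adj a b → G.Adj x y → s(a, b) ≠ s(x, y) →
      c s(a, b) = 0 → c s(x, y) = 0 →
      a ≠ x ∧ a ≠ y ∧ b ≠ x ∧ b ≠ y) ∧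
  ∀ a b x y : V, G.Adj a b → G.Adj x y → s(a, b) ≠ s(x, y) →
      c s(a, b) = c s(x, y) → c s(a, b) ≠ 0 →
      (a ≠ x ∧ a ≠ y ∧ b ≠ x ∧ b ≠ y) ∧
      ¬G.Adj a x ∧ ¬G.Adj a y ∧ ¬G.Adj b x ∧ ¬G.Adj b y

/-- A good coloring: a `(1,2^7)`-packing edge-coloring in which every edge of the
1-color class (color `0`) has both endpoints of degree 3. -/
def GoodColoring {V : Type} (G : SimpleGraph V) (c : Sym2 V → Fin 8) : Prop :=
  IsPackingEC G 7 c ∧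
  ∀ a b : V, G.Adj a b → c s(a, b) = 0 →
    (G.neighborSet a).ncard = 3 ∧ (G.neighborSet b).ncard = 3

/-- A graph is subcubic if every vertex has degree at most 3. -/
def Subcubic {V : Type} (G : SimpleGraph V) : Prop :=
  ∀ v : V, (G.neighborSet v).ncard ≤ 3

/-- A minimal counterexample: a finite subcubic simple graph with no good coloring such
that every finite subcubic simple graph with smaller `|V| + |E|` has a good coloring. -/
def MinCounter (V : Type) [Finite V] (G : SimpleGraph V) : Prop :=
  Subcubic G ∧
  (¬∃ c : Sym2 V → Fin 8, GoodColoring G c) ∧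
  ∀ (W : Type) [Finite W] (H : SimpleGraph W), Subcubic H →
    Nat.card W + H.edgeSet.ncard < Nat.card V + G.edgeSet.ncard →
    ∃ c : Sym2 W → Fin 8, GoodColoring H c

section Kernel

/-! List operations written with bare recursors, so that the kernel evaluates them quickly. -/

noncomputable def recAll {α : Type} (p : α → Bool) (l : List α) : Bool :=
  List.rec true (fun x _ ih => cond (p x) ih false) l

noncomputable def recAny {α : Type} (p : α → Bool) (l : List α) : Bool :=
  List.rec false (fun x _ ih => cond (p x) true ih) l

noncomputable def recFilter {α : Type} (p : α → Bool) (l : List α) : List α :=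
  List.rec [] (fun x _ ih => cond (p x) (x :: ih) ih) l

noncomputable def recMap {α β : Type} (f : α → β) (l : List α) : List β :=
  List.rec [] (fun x _ ih => f x :: ih) l

noncomputable def recAppend {α : Type} (l m : List α) : List α :=
  List.rec m (fun x _ ih => x :: ih) l

noncomputable def recFlatMap {α β : Type} (f : α → List β) (l : List α) : List β :=
  List.rec [] (fun x _ ih => recAppend (f x) ih) l

noncomputable def recEmpty {α : Type} (l : List α) : Bool :=
  List.rec true (fun _ _ _ => false) l

/-- `force n f` is `f n`, but makes the kernel evaluate `n` to a numeral first. -/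
noncomputable def force {α : Type} (n : ℕ) (f : ℕ → α) : α :=
  Nat.rec (f 0) (fun k _ => f (Nat.succ k)) n

def testB (m i : ℕ) : Bool := Nat.beq (Nat.land (Nat.shiftRight m i) 1) 1

def isZero (n : ℕ) : Bool := Nat.beq n 0

@[simp] lemma recAll_eq {α : Type} (p : α → Bool) (l : List α) : recAll p l = l.all p := by
  induction l with
  | nil => rfl
  | cons x t ih => rw [List.all_cons, ← ih]; cases h : p x <;> simp [recAll, h]

@[simp] lemma recAny_eq {α : Type} (p : α → Bool) (l : List α) : recAny p l = l.any p := by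
  induction l with
  | nil => rfl
  | cons x t ih => rw [List.any_cons, ← ih]; cases h : p x <;> simp [recAny, h]

@[simp] lemma recFilter_eq {α : Type} (p : α → Bool) (l : List α) :
    recFilter p l = l.filter p := by
  induction l with
  | nil => rfl
  | cons x t ih => rw [List.filter_cons, ← ih]; cases h : p x <;> simp [recFilter, h]

@[simp] lemma recMap_eq {α β : Type} (f : α → β) (l : List α) : recMap f l = l.map f := by
  induction l with
  | nil => rfl
  | cons x t ih => rw [List.map_cons, ← ih]; rfl

@[simp] lemma recAppend_eq {α : Type} (l m : List α) : recAppend l m = l ++ m := by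
  induction l with
  | nil => rfl
  | cons x t ih => rw [List.cons_append, ← ih]; rfl

@[simp] lemma recFlatMap_eq {α β : Type} (f : α → List β) (l : List α) :
    recFlatMap f l = l.flatMap f := by
  induction l with
  | nil => rfl
  | cons x t ih => rw [List.flatMap_cons, ← ih, ← recAppend_eq]; rfl

@[simp] lemma recEmpty_eq {α : Type} (l : List α) : recEmpty l = l.isEmpty := by
  cases l <;> rfl

@[simp] lemma force_eq {α : Type} (n : ℕ) (f : ℕ → α) : force n f = f n := by
  cases n <;> rfl

lemma natBeq_eq_decide (a b : ℕ) : Nat.beq a b = decide (a = b) := by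
  by_cases h : a = b
  · simp [h]
  · rw [decide_eq_false h, Bool.eq_false_iff]
    exact fun h2 => h (Nat.eq_of_beq_eq_true h2)

@[simp] lemma testB_eq (m i : ℕ) : testB m i = m.testBit i := by
  have h : testB m i = Nat.beq ((m >>> i) &&& 1) 1 := rfl
  rw [h, natBeq_eq_decide, Nat.testBit, Nat.and_comm, Nat.one_and_eq_mod_two]
  rcases Nat.mod_two_eq_zero_or_one (m >>> i) with h | h <;> simp [h]

@[simp] lemma isZero_eq (n : ℕ) : isZero n = decide (n = 0) := natBeq_eq_decide n 0

end Kernel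

section Solver

noncomputable def isDis (d : List (ℕ × ℕ)) (i j : ℕ) : Bool :=
  recAny (fun q => cond (Nat.beq q.1 i) (Nat.beq q.2 j)
    (cond (Nat.beq q.1 j) (Nat.beq q.2 i) false)) d

noncomputable def nbrCount (adj : ℕ → ℕ → Bool) (i : ℕ) (l : List (ℕ × ℕ)) : ℕ :=
  List.rec 0 (fun q _ ih => cond (adj i q.1) (Nat.succ ih) ih) l

noncomputable def peel (adj : ℕ → ℕ → Bool) (l : List (ℕ × ℕ)) :
    List (ℕ × ℕ) → List (ℕ × ℕ) :=
  List.rec (fun d => d) (fun v t ih d =>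
    cond (Nat.ble v.2 (Nat.add (nbrCount adj v.1 d) (nbrCount adj v.1 t))) (ih (v :: d))
      (ih d)) l

noncomputable def losers (d : List (ℕ × ℕ)) (l : List ℕ) : List (List ℕ) :=
  List.rec [[]] (fun v _ ih => recFlatMap (fun T =>
    cond (recAny (isDis d v) T) [T, v :: recFilter (fun x => cond (isDis d v x) false true) T]
      [v :: T]) ih) l

noncomputable def shrink (T : List ℕ) (l : List (ℕ × ℕ)) : List (ℕ × ℕ) :=
  recMap (fun p => cond (recAny (fun x => Nat.beq x p.1) T)
    (force (Nat.pred p.2) fun s => (p.1, s)) p) l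

noncomputable def dropPair (u v : ℕ) (l : List (ℕ × ℕ)) : List (ℕ × ℕ) :=
  recFilter (fun p => cond (Nat.beq p.1 u) false (cond (Nat.beq p.1 v) false true)) l

noncomputable def atRisk (adj : ℕ → ℕ → Bool) (d : List (ℕ × ℕ)) (u v : ℕ)
    (m : List (ℕ × ℕ)) : List ℕ :=
  recMap Prod.fst (recFilter (fun p => cond (cond (adj p.1 u) true (adj p.1 v))
    (cond (isDis d p.1 u) false (cond (isDis d p.1 v) false true)) false) m)

noncomputable def afterShare (adj : ℕ → ℕ → Bool) (l d : List (ℕ × ℕ)) (u v : ℕ) :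
    List (List (ℕ × ℕ)) :=
  (fun m => recMap (fun T => shrink T m) (losers d (atRisk adj d u v m))) (dropPair u v l)

noncomputable def weight (d l : List (ℕ × ℕ)) : List ℕ → ℕ :=
  List.rec (fun _ => 0) (fun v _ ih acc =>
    cond (recAll (isDis d v.1) acc)
      (force (ih acc) fun a => force (Nat.add v.2 (ih (v.1 :: acc))) fun b =>
        cond (Nat.ble a b) b a)
      (ih acc)) l

noncomputable def hall (d l : List (ℕ × ℕ)) : List (ℕ × ℕ) → Bool :=
  List.rec (fun acc => Nat.ble acc.length (weight d acc []))
    (fun v _ ih acc => cond (ih (v :: acc)) (ih acc) false) l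

noncomputable def pairs (p : ℕ × ℕ → ℕ × ℕ → Bool) (l : List (ℕ × ℕ)) :
    List ((ℕ × ℕ) × (ℕ × ℕ)) :=
  List.rec []
    (fun u t ih => recAppend (recMap (fun v => (u, v)) (recFilter (p u) t)) ih) l

noncomputable def solve (adj : ℕ → ℕ → Bool) (fuel : ℕ) :
    ℕ → List (ℕ × ℕ) → List (ℕ × ℕ) → Bool :=
  Nat.rec (fun _ _ _ => false) (fun _ ih dp l d =>
    (fun m => cond (recEmpty m) true
      (cond (Nat.blt m.length l.length) (ih dp m d)
        ((fun ps =>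
          cond (recAny (fun q => cond (Nat.ble (Nat.add q.1.2 q.2.2) 7) false
            (recAll (fun l' => ih dp l' d) (afterShare adj m d q.1.1 q.2.1))) ps) true
          (cond (cond (recEmpty d) false (hall d m [])) true
            (Nat.rec false (fun dp _ => recAny (fun q =>
              cond (recAll (fun l' => ih dp l' d) (afterShare adj m d q.1.1 q.2.1))
                (ih dp m ((q.1.1, q.2.1) :: d)) false) ps)
              dp)))
          (pairs (fun u v => cond (adj u.1 v.1) false
            (cond (isDis d u.1 v.1) false true)) m))))
      (peel adj l [])) fuel

structure Fits (L : ℕ → Finset (Fin 7)) (l d : List (ℕ × ℕ)) : Prop where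
  size : ∀ p ∈ l, p.2 ≤ (L p.1).card
  dis : ∀ i j, isDis d i j = true → Disjoint (L i) (L j)

def Colors (adj : ℕ → ℕ → Bool) (L : ℕ → Finset (Fin 7)) (l : List (ℕ × ℕ))
    (φ : ℕ → Fin 7) : Prop :=
  (∀ p ∈ l, φ p.1 ∈ L p.1) ∧
    ∀ p ∈ l, ∀ q ∈ l, p.1 ≠ q.1 → adj p.1 q.1 = true → φ p.1 ≠ φ q.1

lemma isDis_cons (d : List (ℕ × ℕ)) (u v i j : ℕ) : isDis ((u, v) :: d) i j = true ↔
    (u = i ∧ v = j) ∨ (u = j ∧ v = i) ∨ isDis d i j = true := by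
  simp only [isDis, recAny_eq, List.any_cons, Bool.or_eq_true]
  rw [← or_assoc]
  apply or_congr_left
  by_cases h : u = i <;> by_cases h2 : u = j <;> simp [h, h2] <;> grind

lemma nbrCount_eq (adj : ℕ → ℕ → Bool) (i : ℕ) (l : List (ℕ × ℕ)) :
    nbrCount adj i l = (l.filter fun q => adj i q.1).length := by
  induction l with
  | nil => rfl
  | cons x t ih =>
    rw [List.filter_cons]
    cases h : adj i x.1
    · simp only [Bool.false_eq_true, if_false, ← ih]; simp [nbrCount, h]
    · simp only [if_true, List.length_cons, ← ih]; simp [nbrCount, h]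

lemma peel_cons (adj : ℕ → ℕ → Bool) (v : ℕ × ℕ) (t d : List (ℕ × ℕ)) :
    peel adj (v :: t) d =
      if v.2 ≤ nbrCount adj v.1 d + nbrCount adj v.1 t then peel adj t (v :: d)
      else peel adj t d := by
  have : peel adj (v :: t) d =
    cond (Nat.ble v.2 (nbrCount adj v.1 d + nbrCount adj v.1 t)) (peel adj t (v :: d))
      (peel adj t d) := rfl
  rw [this]
  split_ifs with h
  · rw [Nat.ble_eq_true_of_le h]; rfl
  · rw [Bool.eq_false_iff.2 fun h2 => h (Nat.le_of_ble_eq_true h2)]; rfl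

lemma peel_subset (adj : ℕ → ℕ → Bool) (l d : List (ℕ × ℕ)) :
    ∀ p ∈ peel adj l d, p ∈ l ∨ p ∈ d := by
  induction l generalizing d with
  | nil => intro p hp; exact Or.inr hp
  | cons v t ih =>
    intro p hp
    rw [peel_cons] at hp
    split_ifs at hp
    · rcases ih _ p hp with h | h <;> simp at h ⊢ <;> tauto
    · rcases ih _ p hp with h | h <;> simp <;> tauto

variable {adj : ℕ → ℕ → Bool} {L : ℕ → Finset (Fin 7)}

lemma Fits.mono {l m d : List (ℕ × ℕ)} (h : Fits L l d) (hs : ∀ p ∈ m, p ∈ l) : Fits L m d :=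
  ⟨fun p hp => h.size p (hs p hp), h.dis⟩

lemma Colors.insert (hs : ∀ i j, adj i j = adj j i) {l : List (ℕ × ℕ)} {φ : ℕ → Fin 7}
    (h : Colors adj L l φ) (v : ℕ × ℕ)
    (hv : nbrCount adj v.1 l < (L v.1).card) : ∃ φ, Colors adj L (v :: l) φ := by
  by_cases hm : ∃ p ∈ l, p.1 = v.1
  · obtain ⟨p, hp, hpv⟩ := hm
    refine ⟨φ, ?_, ?_⟩
    · intro q hq
      rcases List.mem_cons.1 hq with rfl | hq
      · rw [← hpv]; exact h.1 p hp
      · exact h.1 q hq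
    · intro q hq r hr
      have key : ∀ q ∈ v :: l, ∃ q' ∈ l, q'.1 = q.1 := by
        intro q hq
        rcases List.mem_cons.1 hq with rfl | hq
        · exact ⟨p, hp, hpv⟩
        · exact ⟨q, hq, rfl⟩
      obtain ⟨q', hq', e1⟩ := key q hq
      obtain ⟨r', hr', e2⟩ := key r hr
      rw [← e1, ← e2]
      exact h.2 q' hq' r' hr'
  · push Not at hm
    rw [nbrCount_eq] at hv
    obtain ⟨c, hc, hcn⟩ : ∃ c ∈ L v.1, c ∉ ((l.filter fun q => adj v.1 q.1).map
        fun q => φ q.1).toFinset := by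
      by_contra hcon
      push Not at hcon
      have := Finset.card_le_card (show L v.1 ⊆ _ from hcon)
      have h2 := List.toFinset_card_le ((l.filter fun q => adj v.1 q.1).map fun q => φ q.1)
      rw [List.length_map] at h2
      omega
    have hcn' : ∀ q ∈ l, adj v.1 q.1 = true → c ≠ φ q.1 := by
      intro q hq ha he
      apply hcn
      simp only [List.mem_toFinset, List.mem_map, List.mem_filter]
      exact ⟨q, ⟨hq, ha⟩, he.symm⟩
    refine ⟨Function.update φ v.1 c, ?_, ?_⟩
    · intro q hq
      rcases List.mem_cons.1 hq with rfl | hq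
      · simpa using hc
      · rw [Function.update_of_ne (hm q hq)]; exact h.1 q hq
    · intro q hq r hr hne ha
      rcases List.mem_cons.1 hq with hq | hq <;> rcases List.mem_cons.1 hr with hr | hr
      · rw [hq, hr] at hne
        exact absurd rfl hne
      · rw [hq] at ha ⊢
        rw [Function.update_self, Function.update_of_ne (hm r hr)]
        exact hcn' r hr ha
      · rw [hr, hs] at ha
        rw [hr, Function.update_self, Function.update_of_ne (hm q hq)]
        exact (hcn' q hq ha).symm
      · rw [Function.update_of_ne (hm q hq), Function.update_of_ne (hm r hr)]
        exact h.2 q hq r hr hne ha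

lemma Colors.mono {l m : List (ℕ × ℕ)} {φ : ℕ → Fin 7} (h : Colors adj L l φ)
    (hs : ∀ p ∈ m, p ∈ l) : Colors adj L m φ :=
  ⟨fun p hp => h.1 p (hs p hp), fun p hp q hq => h.2 p (hs p hp) q (hs q hq)⟩

lemma Colors.of_peel (hs : ∀ i j, adj i j = adj j i) (l d : List (ℕ × ℕ))
    (hf : ∀ p ∈ l, p.2 ≤ (L p.1).card) (h : ∃ φ, Colors adj L (peel adj l d) φ) :
    ∃ φ, Colors adj L (l ++ d) φ := by
  induction l generalizing d with
  | nil => exact h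
  | cons v t ih =>
    rw [peel_cons] at h
    have hf' : ∀ p ∈ t, p.2 ≤ (L p.1).card := fun p hp => hf p (List.mem_cons_of_mem _ hp)
    split_ifs at h with hc
    · obtain ⟨φ, hφ⟩ := ih _ hf' h
      exact ⟨φ, hφ.mono fun p hp => by simp at hp ⊢; tauto⟩
    · obtain ⟨φ, hφ⟩ := ih _ hf' h
      apply hφ.insert hs v
      have := hf v List.mem_cons_self
      rw [nbrCount_eq, nbrCount_eq] at hc
      rw [nbrCount_eq, List.filter_append, List.length_append]
      omega

lemma exists_losers (d : List (ℕ × ℕ)) (S : Set ℕ)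
    (hS : ∀ i ∈ S, ∀ j ∈ S, ¬isDis d i j = true) (l : List ℕ) :
    ∃ T ∈ losers d l, ∀ i ∈ l, i ∈ S → i ∈ T := by
  induction l with
  | nil => exact ⟨[], by simp [losers], by simp⟩
  | cons v r ih =>
    obtain ⟨T, hT, hTS⟩ := ih
    have e : losers d (v :: r) = (losers d r).flatMap fun T =>
      cond (T.any (isDis d v)) [T, v :: T.filter (fun x => cond (isDis d v x) false true)]
        [v :: T] := by
      rw [← recFlatMap_eq]; simp only [← recAny_eq, ← recFilter_eq]; rfl
    rw [e]
    by_cases ha : T.any (isDis d v) = true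
    · by_cases hv : v ∈ S
      · refine ⟨v :: T.filter (fun x => cond (isDis d v x) false true), ?_, ?_⟩
        · rw [List.mem_flatMap]; exact ⟨T, hT, by simp [ha]⟩
        · intro i hi hiS
          rcases List.mem_cons.1 hi with rfl | hi
          · simp
          · apply List.mem_cons_of_mem
            rw [List.mem_filter]
            refine ⟨hTS i hi hiS, ?_⟩
            rw [Bool.eq_false_iff.2 (hS v hv i hiS)]; rfl
      · refine ⟨T, ?_, ?_⟩
        · rw [List.mem_flatMap]; exact ⟨T, hT, by simp [ha]⟩
        · intro i hi hiS
          rcases List.mem_cons.1 hi with rfl | hi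
          · exact absurd hiS hv
          · exact hTS i hi hiS
    · refine ⟨v :: T, ?_, ?_⟩
      · rw [List.mem_flatMap]; exact ⟨T, hT, by simp [ha]⟩
      · intro i hi hiS
        rcases List.mem_cons.1 hi with rfl | hi
        · simp
        · exact List.mem_cons_of_mem _ (hTS i hi hiS)

lemma mem_dropPair {u v : ℕ} {l : List (ℕ × ℕ)} {p : ℕ × ℕ} :
    p ∈ dropPair u v l ↔ p ∈ l ∧ p.1 ≠ u ∧ p.1 ≠ v := by
  simp only [dropPair, recFilter_eq, List.mem_filter, natBeq_eq_decide]
  by_cases h : p.1 = u <;> by_cases h2 : p.1 = v <;> simp [h, h2]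

lemma mem_atRisk {d m : List (ℕ × ℕ)} {u v i : ℕ} :
    i ∈ atRisk adj d u v m ↔ (∃ p ∈ m, p.1 = i) ∧ (adj i u = true ∨ adj i v = true) ∧
      ¬isDis d i u = true ∧ ¬isDis d i v = true := by
  simp only [atRisk, recFilter_eq, recMap_eq, List.mem_map, List.mem_filter]
  constructor
  · rintro ⟨p, ⟨hp, h⟩, rfl⟩
    refine ⟨⟨p, hp, rfl⟩, ?_⟩
    cases h1 : adj p.1 u <;> cases h2 : adj p.1 v <;> cases h3 : isDis d p.1 u <;>
      cases h4 : isDis d p.1 v <;> simp_all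
  · rintro ⟨⟨p, hp, rfl⟩, h⟩
    refine ⟨p, ⟨hp, ?_⟩, rfl⟩
    cases h1 : adj p.1 u <;> cases h2 : adj p.1 v <;> cases h3 : isDis d p.1 u <;>
      cases h4 : isDis d p.1 v <;> simp_all

lemma mem_shrink {T : List ℕ} {l : List (ℕ × ℕ)} {p : ℕ × ℕ} (hp : p ∈ shrink T l) :
    ∃ q ∈ l, q.1 = p.1 ∧ p.2 ≤ q.2 ∧ (p.1 ∈ T → p.2 ≤ q.2 - 1) := by
  simp only [shrink, recMap_eq, recAny_eq, force_eq, List.mem_map] at hp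
  obtain ⟨q, hq, rfl⟩ := hp
  refine ⟨q, hq, ?_⟩
  cases h : T.any fun x => Nat.beq x q.1
  · have : q.1 ∉ T := fun hm => by
      have : (T.any fun x => Nat.beq x q.1) = true := List.any_eq_true.2 ⟨q.1, hm, by simp⟩
      simp [h] at this
    simp [this]
  · simp

lemma exists_mem_shrink (T : List ℕ) {l : List (ℕ × ℕ)} {q : ℕ × ℕ} (hq : q ∈ l) :
    ∃ p ∈ shrink T l, p.1 = q.1 := by
  simp only [shrink, recMap_eq, recAny_eq, force_eq, List.mem_map]
  refine ⟨_, ⟨q, hq, rfl⟩, ?_⟩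
  cases h : T.any fun x => Nat.beq x q.1 <;> rfl

lemma Colors.of_share (hs : ∀ i j, adj i j = adj j i) {m d : List (ℕ × ℕ)} {u v : ℕ}
    (hf : Fits L m d) (huv : adj u v = false) (hnd : ¬Disjoint (L u) (L v))
    (h : ∀ l' ∈ afterShare adj m d u v, ∀ L', Fits L' l' d → ∃ φ, Colors adj L' l' φ) :
    ∃ φ, Colors adj L m φ := by
  obtain ⟨a, hau, hav⟩ := Finset.not_disjoint_iff.1 hnd
  obtain ⟨T, hT, hTS⟩ := exists_losers d {i | a ∈ L i} (fun i hi j hj hd =>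
    Finset.disjoint_left.1 (hf.dis i j hd) hi hj) (atRisk adj d u v (dropPair u v m))
  let L' : ℕ → Finset (Fin 7) := fun i =>
    if adj i u = true ∨ adj i v = true then (L i).erase a else L i
  have hL' : ∀ i, L' i ⊆ L i := by
    intro i
    simp only [L']
    split_ifs
    · exact Finset.erase_subset _ _
    · exact subset_rfl
  obtain ⟨φ, hφ⟩ := h (shrink T (dropPair u v m)) (by
      simp only [afterShare, recMap_eq, List.mem_map]; exact ⟨T, hT, rfl⟩) L' ⟨by
      intro p hp
      obtain ⟨q, hq, hqp, h1, h2⟩ := mem_shrink hp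
      have hqs := hf.size q (mem_dropPair.1 hq).1
      rw [hqp] at hqs
      simp only [L']
      split_ifs with hadj
      · by_cases ha : a ∈ L p.1
        · rw [Finset.card_erase_of_mem ha]
          have : p.1 ∈ T := hTS _ (mem_atRisk.2 ⟨⟨q, hq, hqp⟩, hadj,
            fun hd => Finset.disjoint_left.1 (hf.dis _ _ hd) ha hau,
            fun hd => Finset.disjoint_left.1 (hf.dis _ _ hd) ha hav⟩) ha
          have := h2 this
          omega
        · rw [Finset.erase_eq_of_notMem ha]; omega
      · omega, fun i j hij => (hf.dis i j hij).mono (hL' i) (hL' j)⟩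
  have hne : ∀ q ∈ m, q.1 ≠ u → q.1 ≠ v → φ q.1 ∈ L' q.1 := by
    intro q hq h1 h2
    obtain ⟨p, hp, hpq⟩ := exists_mem_shrink T (mem_dropPair.2 ⟨hq, h1, h2⟩)
    rw [← hpq]; exact hφ.1 p hp
  have hcol : ∀ q ∈ m, q.1 ≠ u → q.1 ≠ v → (adj q.1 u = true ∨ adj q.1 v = true) →
      φ q.1 ≠ a := by
    intro q hq h1 h2 h3 he
    have := hne q hq h1 h2
    simp only [L', if_pos h3, he, Finset.mem_erase] at this
    exact this.1 rfl
  refine ⟨fun i => if i = u ∨ i = v then a else φ i, ?_, ?_⟩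
  · intro q hq
    dsimp only
    split_ifs with hc
    · rcases hc with hc | hc <;> rw [hc] <;> assumption
    · push Not at hc
      exact hL' _ (hne q hq hc.1 hc.2)
  · intro p hp q hq hpq ha
    dsimp only
    split_ifs with h1 h2 h2
    · exfalso
      rcases h1 with h1 | h1 <;> rcases h2 with h2 | h2 <;> rw [h1, h2] at hpq ha
      · exact hpq rfl
      · rw [huv] at ha; exact absurd ha (by simp)
      · rw [hs, huv] at ha; exact absurd ha (by simp)
      · exact hpq rfl
    · push Not at h2
      refine (hcol q hq h2.1 h2.2 ?_).symm
      rw [hs]; rw [hs q.1 v]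
      rcases h1 with h1 | h1 <;> rw [h1] at ha <;> simp [ha]
    · push Not at h1
      refine hcol p hp h1.1 h1.2 ?_
      rcases h2 with h2 | h2 <;> rw [h2] at ha <;> simp [ha]
    · push Not at h1 h2
      obtain ⟨p', hp', e1⟩ := exists_mem_shrink T (mem_dropPair.2 ⟨hp, h1⟩)
      obtain ⟨q', hq', e2⟩ := exists_mem_shrink T (mem_dropPair.2 ⟨hq, h2⟩)
      rw [← e1, ← e2] at hpq ha ⊢
      exact hφ.2 p' hp' q' hq' hpq ha

lemma weight_le (d : List (ℕ × ℕ)) (l : List (ℕ × ℕ)) (acc : List ℕ)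
    (hd : ∀ i j, isDis d i j = true → Disjoint (L i) (L j))
    (hl : ∀ p ∈ l, p.2 ≤ (L p.1).card) (S : Finset (Fin 7))
    (hS : ∀ p ∈ l, (∀ i ∈ acc, isDis d p.1 i = true) → L p.1 ⊆ S) : weight d l acc ≤ S.card := by
  induction l generalizing acc S with
  | nil => exact Nat.zero_le _
  | cons v t ih =>
    have hl' : ∀ p ∈ t, p.2 ≤ (L p.1).card := fun p hp => hl p (List.mem_cons_of_mem _ hp)
    have h1 : weight d t acc ≤ S.card :=
      ih acc hl' S fun p hp => hS p (List.mem_cons_of_mem _ hp)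
    have e : weight d (v :: t) acc = cond (acc.all (isDis d v.1))
      (cond (Nat.ble (weight d t acc) (v.2 + weight d t (v.1 :: acc)))
        (v.2 + weight d t (v.1 :: acc)) (weight d t acc)) (weight d t acc) := by
      have e1 : weight d (v :: t) acc = cond (recAll (isDis d v.1) acc)
        (force (weight d t acc) fun a => force (Nat.add v.2 (weight d t (v.1 :: acc))) fun b =>
          cond (Nat.ble a b) b a) (weight d t acc) := rfl
      rw [e1, recAll_eq, force_eq, force_eq]; rfl
    rw [e]
    cases hacc : acc.all (isDis d v.1)
    · exact h1
    · have hv : L v.1 ⊆ S := hS v List.mem_cons_self (List.all_eq_true.1 hacc)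
      have h2 : weight d t (v.1 :: acc) ≤ (S \ L v.1).card := by
        apply ih _ hl'
        intro p hp hi
        rw [Finset.subset_sdiff]
        refine ⟨hS p (List.mem_cons_of_mem _ hp) fun i h => hi i (List.mem_cons_of_mem _ h), ?_⟩
        exact hd _ _ (hi _ List.mem_cons_self)
      rw [Finset.card_sdiff_of_subset hv] at h2
      have h3 := Finset.card_le_card hv
      have h4 := hl v List.mem_cons_self
      cases Nat.ble (weight d t acc) (v.2 + weight d t (v.1 :: acc)) <;> simp <;> omega

lemma le_weight_of_hall (d l : List (ℕ × ℕ)) (acc : List (ℕ × ℕ)) (h : hall d l acc = true)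
    (p : ℕ × ℕ → Bool) : ∃ T : List (ℕ × ℕ), T.Perm (l.filter p ++ acc) ∧
      T.length ≤ weight d T [] := by
  induction l generalizing acc with
  | nil => exact ⟨acc, List.Perm.refl _, Nat.le_of_ble_eq_true h⟩
  | cons v t ih =>
    have e : hall d (v :: t) acc = cond (hall d t (v :: acc)) (hall d t acc) false := rfl
    rw [e] at h
    cases h1 : hall d t (v :: acc)
    · rw [h1] at h; exact absurd h (by simp)
    · rw [h1] at h
      rw [List.filter_cons]
      split_ifs
      · obtain ⟨T, hT, hw⟩ := ih _ h1
        exact ⟨T, hT.trans List.perm_middle, hw⟩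
      · exact ih _ h

lemma Colors.of_hall {m d : List (ℕ × ℕ)} (hf : Fits L m d) (h : hall d m [] = true) :
    ∃ φ, Colors adj L m φ := by
  have key : ∀ s : Finset {i // i ∈ m.map Prod.fst},
      s.card ≤ (s.biUnion fun i => L i.1).card := by
    intro s
    obtain ⟨T, hT, hw⟩ := le_weight_of_hall d m [] h
      fun p => decide (p.1 ∈ s.map ⟨_, Subtype.val_injective⟩)
    rw [List.append_nil] at hT
    have hmem : ∀ p ∈ T, p ∈ m ∧ p.1 ∈ s.map ⟨_, Subtype.val_injective⟩ := by
      intro p hp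
      simpa using List.mem_filter.1 (hT.mem_iff.1 hp)
    have h1 : s.card ≤ T.length := by
      have : s.map ⟨_, Subtype.val_injective⟩ ⊆ (T.map Prod.fst).toFinset := by
        intro i hi
        obtain ⟨x, hx, rfl⟩ := Finset.mem_map.1 hi
        obtain ⟨p, hp, hpx⟩ := List.mem_map.1 x.2
        rw [List.mem_toFinset, List.mem_map]
        exact ⟨p, hT.mem_iff.2 (List.mem_filter.2 ⟨hp, by
          rw [decide_eq_true_iff, hpx]; exact hi⟩), hpx⟩
      have h2 := Finset.card_le_card this
      rw [Finset.card_map] at h2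
      have h3 := List.toFinset_card_le (T.map Prod.fst)
      rw [List.length_map] at h3
      omega
    refine h1.trans (hw.trans (weight_le d T [] hf.dis (fun p hp => hf.size p (hmem p hp).1) _ ?_))
    intro p hp _
    obtain ⟨x, hx, hxp⟩ := Finset.mem_map.1 (hmem p hp).2
    rw [← hxp]
    exact Finset.subset_biUnion_of_mem (fun i : {i // i ∈ m.map Prod.fst} => L i.1) hx
  obtain ⟨g, hg, hgL⟩ := (Finset.all_card_le_biUnion_card_iff_exists_injective _).1 key
  refine ⟨fun i => if hi : i ∈ m.map Prod.fst then g ⟨i, hi⟩ else 0, ?_, ?_⟩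
  · intro p hp
    have hi : p.1 ∈ m.map Prod.fst := List.mem_map_of_mem hp
    simp only [dif_pos hi]
    exact hgL ⟨_, hi⟩
  · intro p hp q hq hne _
    have hi : p.1 ∈ m.map Prod.fst := List.mem_map_of_mem hp
    have hj : q.1 ∈ m.map Prod.fst := List.mem_map_of_mem hq
    simp only [dif_pos hi, dif_pos hj]
    exact fun he => hne (congrArg Subtype.val (hg he))

lemma of_mem_pairs {p : ℕ × ℕ → ℕ × ℕ → Bool} {l : List (ℕ × ℕ)} {q : (ℕ × ℕ) × (ℕ × ℕ)}
    (hq : q ∈ pairs p l) : q.1 ∈ l ∧ q.2 ∈ l ∧ p q.1 q.2 = true := by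
  induction l with
  | nil => exact absurd hq (by simp [pairs])
  | cons u t ih =>
    have e : pairs p (u :: t) = (t.filter (p u)).map (fun v => (u, v)) ++ pairs p t := by
      rw [← recFilter_eq, ← recMap_eq, ← recAppend_eq]; rfl
    rw [e, List.mem_append, List.mem_map] at hq
    rcases hq with ⟨v, hv, rfl⟩ | hq
    · rw [List.mem_filter] at hv
      exact ⟨List.mem_cons_self, List.mem_cons_of_mem _ hv.1, hv.2⟩
    · obtain ⟨h1, h2, h3⟩ := ih hq
      exact ⟨List.mem_cons_of_mem _ h1, List.mem_cons_of_mem _ h2, h3⟩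

theorem exists_colors_of_solve (hs : ∀ i j, adj i j = adj j i) (fuel dp : ℕ)
    (l d : List (ℕ × ℕ)) (h : solve adj fuel dp l d = true)
    (L : ℕ → Finset (Fin 7)) (hf : Fits L l d) : ∃ φ, Colors adj L l φ := by
  induction fuel generalizing dp l d L with
  | zero => exact absurd h (by simp [solve])
  | succ n ih =>
    suffices H : ∃ φ, Colors adj L (peel adj l []) φ by
      simpa using Colors.of_peel hs l [] hf.size H
    have hfm : Fits L (peel adj l []) d :=
      hf.mono fun p hp => by simpa using peel_subset adj l [] p hp
    have e : solve adj (n + 1) dp l d = (fun m => cond (recEmpty m) true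
      (cond (Nat.blt m.length l.length) (solve adj n dp m d)
        ((fun ps =>
          cond (recAny (fun q => cond (Nat.ble (Nat.add q.1.2 q.2.2) 7) false
            (recAll (fun l' => solve adj n dp l' d) (afterShare adj m d q.1.1 q.2.1))) ps) true
          (cond (cond (recEmpty d) false (hall d m [])) true
            (Nat.rec false (fun dp _ => recAny (fun q =>
              cond (recAll (fun l' => solve adj n dp l' d) (afterShare adj m d q.1.1 q.2.1))
                (solve adj n dp m ((q.1.1, q.2.1) :: d)) false) ps)
              dp)))
          (pairs (fun u v => cond (adj u.1 v.1) false
            (cond (isDis d u.1 v.1) false true)) m))))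
      (peel adj l []) := rfl
    rw [e] at h
    generalize peel adj l [] = m at h hfm ⊢
    dsimp only at h
    simp only [Bool.cond_eq_ite, recAny_eq, recAll_eq, recEmpty_eq] at h
    have share : ∀ dp (u v : ℕ), adj u v = false → ¬Disjoint (L u) (L v) →
        (∀ l' ∈ afterShare adj m d u v, solve adj n dp l' d = true) → ∃ φ, Colors adj L m φ := by
      intro dp u v h1 h2 h3
      exact Colors.of_share hs hfm h1 h2 fun l' hl' L' hL' =>
        ih dp l' d (h3 l' hl') L' hL'
    have hnone : Nat.rec (motive := fun _ => Bool) false (fun dp _ =>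
        (pairs (fun u v => if adj u.1 v.1 = true then false
          else if isDis d u.1 v.1 = true then false else true) m).any fun q =>
            if (afterShare adj m d q.1.1 q.2.1).all (fun l' => solve adj n dp l' d) = true then
              solve adj n dp m ((q.1.1, q.2.1) :: d)
            else false) dp = true → ∃ φ, Colors adj L m φ := by
      intro h
      cases dp with
      | zero => exact absurd h (by simp)
      | succ dp =>
        obtain ⟨⟨u, v⟩, hq, h⟩ := List.any_eq_true.1 h
        obtain ⟨hu, hv, huv⟩ := of_mem_pairs hq
        split_ifs at huv h with g1 g2 g3
        by_cases hd : Disjoint (L u.1) (L v.1)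
        · refine ih dp m _ h L ⟨hfm.size, fun i j hij => ?_⟩
          rw [isDis_cons] at hij
          rcases hij with ⟨rfl, rfl⟩ | ⟨rfl, rfl⟩ | hij
          · exact hd
          · exact hd.symm
          · exact hfm.dis i j hij
        · exact share dp u.1 v.1 (by simpa using g1) hd (List.all_eq_true.1 g3)
    split_ifs at h with h1 h2 h3
    · rw [List.isEmpty_iff] at h1
      subst h1
      exact ⟨fun _ => 0, by simp, by simp⟩
    · exact ih dp m d h L hfm
    · obtain ⟨⟨u, v⟩, hq, h3⟩ := List.any_eq_true.1 h3
      obtain ⟨hu, hv, huv⟩ := of_mem_pairs hq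
      split_ifs at huv h3 with g1 g2 g3
      refine share dp u.1 v.1 (by simpa using g1) (fun hd => ?_) (List.all_eq_true.1 h3)
      have c1 := Finset.card_le_univ (L u.1 ∪ L v.1)
      rw [Finset.card_union_of_disjoint hd, Fintype.card_fin] at c1
      have c2 : u.2 ≤ _ := hfm.size _ hu
      have c3 : v.2 ≤ _ := hfm.size _ hv
      exact g3 (Nat.ble_eq_true_of_le (show u.2 + v.2 ≤ 7 by omega))
    all_goals first | exact hnone h | contradiction | exact Colors.of_hall hfm ‹_›

end Solver

section Codes

noncomputable def code (t m l : ℕ) : ℕ := Nat.add t (Nat.add (Nat.mul 8 m) (Nat.mul 512 l))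

noncomputable def tagOf (c : ℕ) : ℕ := Nat.land c 7

noncomputable def maskOf (c : ℕ) : ℕ := Nat.land (Nat.shiftRight c 3) 63

noncomputable def linkOf (c : ℕ) : ℕ := Nat.shiftRight c 9

noncomputable def entry (cs : List ℕ) : ℕ → ℕ :=
  List.rec (fun _ => 0) (fun x _ ih i => Nat.rec x (fun k _ => ih k) i) cs

noncomputable def masks : List ℕ := List.range 64

noncomputable def weight6 (m : ℕ) : ℕ :=
  Nat.add (Nat.land m 1) (Nat.add (Nat.land (Nat.shiftRight m 1) 1)
    (Nat.add (Nat.land (Nat.shiftRight m 2) 1) (Nat.add (Nat.land (Nat.shiftRight m 3) 1)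
      (Nat.add (Nat.land (Nat.shiftRight m 4) 1) (Nat.land (Nat.shiftRight m 5) 1)))))

noncomputable def spread (m : ℕ) : ℕ :=
  Nat.lor m (Nat.land (Nat.lor (Nat.lor (Nat.shiftLeft m 1) (Nat.shiftLeft m 5))
    (Nat.lor (Nat.shiftRight m 1) (Nat.shiftRight m 5))) 63)

noncomputable def maskOk (i t m : ℕ) : Bool :=
  cond (Nat.beq (weight6 m) (entry [2, 2, 3, 2, 1, 1] t))
    (cond (testB m i)
      (cond (Nat.beq t 3) (isZero (Nat.land (spread (Nat.pow 2 i)) (Nat.sub m (Nat.pow 2 i)))) true)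
      false) false

noncomputable def outDeg (t : ℕ) : ℕ := entry [0, 1, 0, 0, 1, 2] t

noncomputable def linkOk (t m l : ℕ) : Bool :=
  cond (Nat.beq (outDeg t) 1) (cond (Nat.ble (weight6 l) 2) (isZero (Nat.land l m)) false)
    (isZero l)

noncomputable def codes (i : ℕ) (tags : List ℕ) : List ℕ :=
  recFlatMap (fun t => recFlatMap (fun m => recMap (fun l => force (code t m l) fun x => x)
    (recFilter (linkOk t m) masks)) (recFilter (maskOk i t) masks)) tags

noncomputable def compat (a b : ℕ) : Bool :=
  cond (Nat.beq a b) true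
    (cond (isZero (Nat.land (maskOf a) (maskOf b)))
      (cond (isZero (Nat.land (linkOf a) (maskOf b))) (isZero (Nat.land (linkOf b) (maskOf a)))
        (cond (Nat.beq (linkOf a) (maskOf b)) (Nat.beq (linkOf b) (maskOf a)) false)) false)

noncomputable def search (chk : List ℕ → Bool) (n : ℕ) : List (List ℕ) → List ℕ → Bool :=
  Nat.rec (fun _ acc => chk acc) (fun _ ih ls acc =>
    List.rec true (fun l r _ => recAll (fun x =>
      ih (recMap (recFilter (compat x)) r) (recAppend acc [x])) l) ls) n

noncomputable def succ6 (k : ℕ) : ℕ := cond (Nat.beq k 5) 0 (Nat.succ k)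

noncomputable def tip (c : ℕ) : ℕ :=
  cond (Nat.beq (tagOf c) 3) (maskOf c) (Nat.shiftLeft (maskOf c) 6)

noncomputable def ends (cs : List ℕ) (k : ℕ) : ℕ :=
  cond (Nat.ble k 5) (Nat.lor (Nat.pow 2 k) (Nat.pow 2 (succ6 k)))
    (Nat.lor (Nat.pow 2 (Nat.sub k 6)) (tip (entry cs (Nat.sub k 6))))

noncomputable def hood (cs : List ℕ) (k : ℕ) : ℕ :=
  cond (Nat.ble k 5)
    (Nat.lor (spread (Nat.lor (Nat.pow 2 k) (Nat.pow 2 (succ6 k))))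
      (Nat.lor (tip (entry cs k)) (tip (entry cs (succ6 k)))))
    ((fun c => cond (Nat.beq (tagOf c) 3) (spread (maskOf c))
      (Nat.lor (spread (Nat.pow 2 (Nat.sub k 6)))
        (Nat.lor (maskOf c) (Nat.shiftLeft (Nat.lor (maskOf c) (linkOf c)) 6))))
      (entry cs (Nat.sub k 6)))

noncomputable def near (cs : List ℕ) (i j : ℕ) : Bool :=
  cond (isZero (Nat.land (ends cs i) (hood cs j)))
    (cond (isZero (Nat.land (ends cs j) (hood cs i))) false true) true

noncomputable def size (cs : List ℕ) (k : ℕ) : ℕ :=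
  cond (Nat.ble k 5)
    (Nat.sub 7 (Nat.add (outDeg (tagOf (entry cs k)))
      (cond (Nat.beq (maskOf (entry cs k)) (maskOf (entry cs (succ6 k)))) 0
        (outDeg (tagOf (entry cs (succ6 k)))))))
    ((fun c => cond (isZero (outDeg (tagOf c))) 7 (cond (isZero (linkOf c)) 4 6))
      (entry cs (Nat.sub k 6)))

noncomputable def present (cs : List ℕ) (k : ℕ) : Bool :=
  cond (Nat.ble k 5) true
    ((fun c => cond (Nat.beq (tagOf c) 5) false
      (cond (Nat.beq (tagOf c) 3) (Nat.blt (maskOf c) (Nat.pow 2 (Nat.sub k 5))) true))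
      (entry cs (Nat.sub k 6)))

noncomputable def zeroOk (cs : List ℕ) (k : ℕ) : Bool :=
  cond (Nat.ble k 5) true
    (cond (Nat.ble 4 (tagOf (entry cs (Nat.sub k 6)))) false
      (Nat.ble 1 (tagOf (entry cs (Nat.sub k 6)))))

noncomputable def forced (cs : List ℕ) : ℕ :=
  List.rec 0 (fun c _ ih => cond (Nat.beq (tagOf c) 5) (Nat.lor (maskOf c) ih) ih) cs

noncomputable def pickZero (cs : List ℕ) (l : List ℕ) : ℕ → List ℕ :=
  List.rec (fun _ => []) (fun k _ ih m =>
    cond (cond (present cs k) (cond (zeroOk cs k) (isZero (Nat.land (ends cs k) m)) false) false)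
      (k :: ih (Nat.lor m (ends cs k))) (ih m)) l

noncomputable def start (cs : List ℕ) (z : List ℕ) : List (ℕ × ℕ) :=
  recMap (fun k => force (size cs k) fun s => (k, s))
    (recFilter (fun k => cond (present cs k)
      (cond (recAny (fun x => Nat.beq x k) z) false true) false)
      [0, 1, 2, 3, 4, 5, 6, 7, 8, 9, 10, 11])

noncomputable def attempt (cs : List ℕ) (order : List ℕ) (dp : ℕ) : Bool :=
  solve (near cs) 30 dp (start cs (pickZero cs order (forced cs))) []

noncomputable def colorable (cs : List ℕ) : Bool :=
  cond (attempt cs [7, 9, 11, 6, 8, 10, 0, 1, 2, 3, 4, 5] 0) true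
    (cond (attempt cs [3, 8, 1, 2, 10, 6, 9, 5, 11, 4, 7, 0] 0) true
      (attempt cs [7, 9, 11, 6, 8, 10, 0, 1, 2, 3, 4, 5] 3))

noncomputable def rank (a : ℕ → ℕ) : ℕ :=
  Nat.add (a 5) (Nat.mul 6 (Nat.add (a 4) (Nat.mul 6 (Nat.add (a 3) (Nat.mul 6
    (Nat.add (a 2) (Nat.mul 6 (Nat.add (a 1) (Nat.mul 6 (a 0))))))))))

noncomputable def dominated (cs : List ℕ) : Bool :=
  force (rank fun i => tagOf (entry cs i)) fun r => recAny (fun j =>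
    cond (Nat.blt r (rank fun i => tagOf (entry cs (Nat.mod (Nat.add i j) 6)))) true
      (Nat.blt r (rank fun i => tagOf (entry cs (Nat.mod (Nat.sub (Nat.add 6 j) i) 6)))))
    [0, 1, 2, 3, 4, 5]

noncomputable def colorableAll (t : ℕ) : Bool :=
  (fun ts => search (fun cs => cond (dominated cs) true (colorable cs)) 6
    [codes 0 [t], codes 1 ts, codes 2 ts, codes 3 ts, codes 4 ts,
    codes 5 ts] []) (List.range (Nat.succ t))

lemma search_sound {chk : List ℕ → Bool} (ls : List (List ℕ)) (acc : List ℕ)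
    (h : search chk ls.length ls acc = true) (xs : List ℕ) (hx : List.Forall₂ (· ∈ ·) xs ls)
    (hc : xs.Pairwise fun a b => compat a b = true) : chk (acc ++ xs) = true := by
  induction xs generalizing ls acc with
  | nil =>
    cases hx
    rw [List.append_nil]
    exact h
  | cons x xs ih =>
    obtain _ | @⟨_, l, _, r, hxl, hxr⟩ := hx
    have e : search chk (l :: r).length (l :: r) acc = l.all fun x =>
        search chk r.length (r.map (List.filter (compat x))) (acc ++ [x]) := by
      have e' : search chk (l :: r).length (l :: r) acc = recAll (fun x =>
        search chk r.length (recMap (recFilter (compat x)) r) (recAppend acc [x])) l := rfl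
      have f : ∀ p : ℕ → Bool, recFilter p = List.filter p := fun p => funext (recFilter_eq p)
      simp only [e', recAll_eq, recMap_eq, recAppend_eq, f]
    rw [e] at h
    have h2 := List.all_eq_true.1 h x hxl
    rw [List.pairwise_cons] at hc
    have := ih (r.map (List.filter (compat x))) (acc ++ [x]) (by rwa [List.length_map]) (by
      rw [List.forall₂_map_right_iff]
      have := hc.1
      clear * - hxr this
      induction hxr with
      | nil => exact List.Forall₂.nil
      | cons h1 h2 ih =>
        exact List.Forall₂.cons (List.mem_filter.2 ⟨h1, this _ List.mem_cons_self⟩)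
          (ih fun y hy => this y (List.mem_cons_of_mem _ hy))) hc.2
    simpa using this

lemma and_ne_zero_of_testBit {a b i : ℕ} (ha : a.testBit i = true) (hb : b.testBit i = true) :
    a &&& b ≠ 0 := by
  intro h
  have := Nat.testBit_and a b i
  rw [h, ha, hb] at this
  simp at this

lemma near_iff (cs : List ℕ) (i j : ℕ) : near cs i j = true ↔
    ends cs i &&& hood cs j ≠ 0 ∨ ends cs j &&& hood cs i ≠ 0 := by
  have e : near cs i j = cond (isZero (ends cs i &&& hood cs j))
    (cond (isZero (ends cs j &&& hood cs i)) false true) true := rfl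
  rw [e, isZero_eq, isZero_eq]
  by_cases h : ends cs i &&& hood cs j = 0 <;> by_cases h2 : ends cs j &&& hood cs i = 0 <;>
    simp [h, h2]

lemma near_comm (cs : List ℕ) (i j : ℕ) : near cs i j = near cs j i := by
  rw [Bool.eq_iff_iff, near_iff, near_iff, or_comm]

lemma pickZero_sound (cs l : List ℕ) (m : ℕ) :
    (∀ k ∈ pickZero cs l m, zeroOk cs k = true ∧ ends cs k &&& m = 0) ∧
      (pickZero cs l m).Pairwise fun k k' => ends cs k &&& ends cs k' = 0 := by
  induction l generalizing m with
  | nil => exact ⟨fun k hk => absurd hk (by simp [pickZero]), List.Pairwise.nil⟩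
  | cons v t ih =>
    have e : pickZero cs (v :: t) m = cond (cond (present cs v) (cond (zeroOk cs v)
        (isZero (ends cs v &&& m)) false) false)
        (v :: pickZero cs t (m ||| ends cs v)) (pickZero cs t m) := rfl
    rw [e, isZero_eq]
    cases hc : cond (present cs v) (cond (zeroOk cs v)
        (decide (ends cs v &&& m = 0)) false) false
    · exact ih m
    · obtain ⟨h1, h2⟩ := ih (m ||| ends cs v)
      have hor : ∀ k ∈ pickZero cs t (m ||| ends cs v),
          ends cs k &&& m = 0 ∧ ends cs k &&& ends cs v = 0 := by
        intro k hk
        have := (h1 k hk).2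
        rwa [Nat.and_or_distrib_left, Nat.or_eq_zero_iff] at this
      simp only [cond_true]
      refine ⟨?_, List.pairwise_cons.2 ⟨fun k hk => ?_, h2⟩⟩
      · intro k hk
        rcases List.mem_cons.1 hk with rfl | hk
        · cases h3 : present cs k <;> cases h4 : zeroOk cs k <;> simp_all
        · exact ⟨(h1 k hk).1, (hor k hk).1⟩
      · rw [Nat.and_comm]
        exact (hor k hk).2

lemma exists_of_attempt {cs order : List ℕ} {dp : ℕ} (h : attempt cs order dp = true) :
    ∃ Z : ℕ → Prop, (∀ k, Z k → zeroOk cs k = true ∧ ends cs k &&& forced cs = 0) ∧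
      (∀ k k', Z k → Z k' → k ≠ k' → ends cs k &&& ends cs k' = 0) ∧
      ∀ L : ℕ → Finset (Fin 7), (∀ k < 12, present cs k = true → size cs k ≤ (L k).card) →
        ∃ φ : ℕ → Fin 7, (∀ k < 12, present cs k = true → ¬Z k → φ k ∈ L k) ∧
          ∀ k < 12, ∀ k' < 12, present cs k = true → present cs k' = true → ¬Z k → ¬Z k' →
            k ≠ k' → ends cs k &&& hood cs k' ≠ 0 → φ k ≠ φ k' := by
  obtain ⟨h1, h2⟩ := pickZero_sound cs order (forced cs)
  refine ⟨fun k => k ∈ pickZero cs order (forced cs), h1, fun k k' hk hk' hne =>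
    haveI : Std.Symm fun k k' => ends cs k &&& ends cs k' = 0 :=
      ⟨fun _ _ h => by rwa [Nat.and_comm]⟩
    h2.forall hk hk' hne, fun L hL => ?_⟩
  have hmem : ∀ p, p ∈ start cs (pickZero cs order (forced cs)) ↔
      p.1 < 12 ∧ present cs p.1 = true ∧ p.1 ∉ pickZero cs order (forced cs) ∧
        p.2 = size cs p.1 := by
    rintro ⟨k, s⟩
    simp only [start, recMap_eq, recFilter_eq, recAny_eq, force_eq, List.mem_map,
      List.mem_filter, Prod.mk.injEq]
    have hr : k ∈ [0, 1, 2, 3, 4, 5, 6, 7, 8, 9, 10, 11] ↔ k < 12 := by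
      simp only [List.mem_cons, List.not_mem_nil, or_false]; omega
    have hz : ((pickZero cs order (forced cs)).any fun x => Nat.beq x k) = true ↔
        k ∈ pickZero cs order (forced cs) := by
      rw [List.any_eq_true]
      constructor
      · rintro ⟨x, hx, he⟩; rwa [← Nat.eq_of_beq_eq_true he]
      · intro hk; exact ⟨k, hk, by simp⟩
    constructor
    · rintro ⟨x, ⟨hx, hp⟩, rfl, rfl⟩
      cases h3 : present cs x
      · simp [h3] at hp
      · refine ⟨hr.1 hx, rfl, fun hk => ?_, rfl⟩
        rw [h3, hz.2 hk] at hp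
        simp at hp
    · rintro ⟨h4, h5, h6, rfl⟩
      refine ⟨k, ⟨hr.2 h4, ?_⟩, rfl, rfl⟩
      rw [h5, Bool.eq_false_iff.2 fun h => h6 (hz.1 h)]
      rfl
  obtain ⟨φ, hφ, hφ2⟩ := exists_colors_of_solve (near_comm cs) _ _ _ _ h L ⟨by
    rintro ⟨k, s⟩ hp
    obtain ⟨h4, h5, -, h6⟩ := (hmem _).1 hp
    exact h6.le.trans (hL k h4 h5), fun i j hij => absurd hij (by simp [isDis])⟩
  refine ⟨φ, fun k hk hp hz => hφ (k, size cs k) ((hmem _).2 ⟨hk, hp, hz, rfl⟩), ?_⟩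
  intro k hk k' hk' hp hp' hz hz' hne hn
  exact hφ2 (k, size cs k) ((hmem _).2 ⟨hk, hp, hz, rfl⟩) (k', size cs k')
    ((hmem _).2 ⟨hk', hp', hz', rfl⟩) hne ((near_iff _ _ _).2 (Or.inl hn))

lemma forced_testBit {cs : List ℕ} {c b : ℕ} (hc : c ∈ cs) (ht : tagOf c = 5)
    (hb : (maskOf c).testBit b = true) : (forced cs).testBit b = true := by
  induction cs with
  | nil => simp at hc
  | cons x t ih =>
    have e : forced (x :: t) = cond (Nat.beq (tagOf x) 5) (maskOf x ||| forced t) (forced t) := rfl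
    rw [e]
    rcases List.mem_cons.1 hc with rfl | hc
    · simp [ht, Nat.testBit_or, hb]
    · cases Nat.beq (tagOf x) 5
      · exact ih hc
      · simp [Nat.testBit_or, ih hc]

def enc (s : Finset (Fin 6)) : ℕ := ∑ j ∈ s, 2 ^ (j : ℕ)

lemma enc_lt (s : Finset (Fin 6)) : enc s < 64 := by
  revert s; decide +kernel

lemma weight6_enc (s : Finset (Fin 6)) : weight6 (enc s) = s.card := by
  revert s; decide +kernel

lemma testBit_enc (s : Finset (Fin 6)) (j : Fin 6) : (enc s).testBit j = decide (j ∈ s) := by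
  revert s j; decide +kernel

lemma testBit_spread (s : Finset (Fin 6)) (j : Fin 6) : (spread (enc s)).testBit j =
    decide (j ∈ s ∨ j + 1 ∈ s ∨ j - 1 ∈ s) := by
  revert s j; decide +kernel

lemma tagOf_code {t m l : ℕ} (ht : t < 8) : tagOf (code t m l) = t := by
  have : tagOf (code t m l) = (t + (8 * m + 512 * l)) &&& (2 ^ 3 - 1) := rfl
  rw [this, Nat.and_two_pow_sub_one_eq_mod]
  omega

lemma maskOf_code {t m l : ℕ} (ht : t < 8) (hm : m < 64) : maskOf (code t m l) = m := by
  have : maskOf (code t m l) = ((t + (8 * m + 512 * l)) >>> 3) &&& (2 ^ 6 - 1) := rfl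
  rw [this, Nat.and_two_pow_sub_one_eq_mod, Nat.shiftRight_eq_div_pow]
  omega

lemma linkOf_code {t m l : ℕ} (ht : t < 8) (hm : m < 64) : linkOf (code t m l) = l := by
  have : linkOf (code t m l) = (t + (8 * m + 512 * l)) >>> 9 := rfl
  rw [this, Nat.shiftRight_eq_div_pow]
  omega

end Codes

section Hexagons

variable {V : Type} {G : SimpleGraph V} {f w : Fin 6 → V}

/-- `f` runs around a `6`-cycle of `G` and `w i` is the third neighbour of `f i`; when there is no
such neighbour, `w i = f i`. -/
structure Hex (G : SimpleGraph V) (f w : Fin 6 → V) : Prop where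
  inj : Function.Injective f
  adj : ∀ i, G.Adj (f i) (f (i + 1))
  nbr : ∀ i y, G.Adj (f i) y → y = f (i + 1) ∨ y = f (i - 1) ∨ y = w i
  third : ∀ i, (G.Adj (f i) (w i) ∧ w i ≠ f (i + 1) ∧ w i ≠ f (i - 1)) ∨ w i = f i

lemma Hex.adj' (h : Hex G f w) (i : Fin 6) : G.Adj (f i) (f (i - 1)) := by
  have := h.adj (i - 1)
  rw [sub_add_cancel] at this
  exact this.symm

lemma Hex.shift (h : Hex G f w) (j : Fin 6) : Hex G (fun i => f (i + j)) (fun i => w (i + j)) where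
  inj := h.inj.comp (add_left_injective j)
  adj i := by rw [add_right_comm]; exact h.adj _
  nbr i y hy := by
    have := h.nbr _ y hy
    rwa [add_right_comm i 1 j, show i - 1 + j = i + j - 1 by abel]
  third i := by
    have := h.third (i + j)
    rwa [add_right_comm i 1 j, show i - 1 + j = i + j - 1 by abel]

lemma Hex.reflect (h : Hex G f w) (j : Fin 6) :
    Hex G (fun i => f (j - i)) (fun i => w (j - i)) where
  inj := h.inj.comp sub_right_injective
  adj i := by
    rw [← sub_sub]
    exact h.adj' _
  nbr i y hy := by
    have := h.nbr _ y hy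
    rw [← sub_sub, show j - (i - 1) = j - i + 1 by abel]
    tauto
  third i := by
    have := h.third (j - i)
    rw [← sub_sub, show j - (i - 1) = j - i + 1 by abel]
    tauto

open Classical in
/-- The kind of the third neighbour `u` of a vertex `v` of the cycle `S`: `5` if it is missing or
has two neighbours off the cycle, `4` if its only neighbour on the cycle is `v`, `3` if it is on the
cycle, `2` if it has three neighbours on the cycle, and `0` or `1` if it has two. -/
noncomputable def kind (G : SimpleGraph V) (S : Set V) (v u : V) : ℕ :=
  if ¬G.Adj v u then 5 else if u ∈ S then 3 else
    if (G.neighborSet u ∩ S).ncard = 1 then (if (G.neighborSet u \ S).ncard = 2 then 5 else 4)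
    else if (G.neighborSet u ∩ S).ncard = 2 then (if (G.neighborSet u \ S).ncard = 0 then 0 else 1)
    else 2

noncomputable def kd (G : SimpleGraph V) (f w : Fin 6 → V) (i : Fin 6) : ℕ :=
  kind G (Set.range f) (f i) (w i)

open Classical in
noncomputable def cls (G : SimpleGraph V) (f w : Fin 6 → V) (i : Fin 6) : Finset (Fin 6) :=
  Finset.univ.filter fun j => if w i ∈ Set.range f then f j = f i ∨ f j = w i else G.Adj (f j) (w i)

open Classical in
noncomputable def link (G : SimpleGraph V) (f w : Fin 6 → V) (i : Fin 6) : Finset (Fin 6) :=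
  Finset.univ.filter fun j => (kd G f w i = 1 ∨ kd G f w i = 4) ∧
    (kd G f w j = 1 ∨ kd G f w j = 4) ∧ G.Adj (w i) (w j)

noncomputable def sig (G : SimpleGraph V) (f w : Fin 6 → V) (i : Fin 6) : ℕ :=
  code (kd G f w i) (enc (cls G f w i)) (enc (link G f w i))

noncomputable def sigs (G : SimpleGraph V) (f w : Fin 6 → V) : List ℕ :=
  [sig G f w 0, sig G f w 1, sig G f w 2, sig G f w 3, sig G f w 4, sig G f w 5]

lemma mem_cls_in {i j : Fin 6} (hi : w i ∈ Set.range f) :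
    j ∈ cls G f w i ↔ f j = f i ∨ f j = w i := by
  simp only [cls, Finset.mem_filter, Finset.mem_univ, true_and, if_pos hi]

lemma mem_cls_out {i j : Fin 6} (hi : w i ∉ Set.range f) :
    j ∈ cls G f w i ↔ G.Adj (f j) (w i) := by
  simp only [cls, Finset.mem_filter, Finset.mem_univ, true_and, if_neg hi]

lemma mem_link {i j : Fin 6} : j ∈ link G f w i ↔ (kd G f w i = 1 ∨ kd G f w i = 4) ∧
    (kd G f w j = 1 ∨ kd G f w j = 4) ∧ G.Adj (w i) (w j) := by
  simp only [link, Finset.mem_filter, Finset.mem_univ, true_and]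

lemma kd_le (i : Fin 6) : kd G f w i ≤ 5 := by
  unfold kd kind
  split_ifs <;> omega

namespace Hex

lemma adj_of_out (h : Hex G f w) {i : Fin 6} (hi : w i ∉ Set.range f) : G.Adj (f i) (w i) := by
  rcases h.third i with h1 | h1
  · exact h1.1
  · exact absurd ⟨i, h1.symm⟩ hi

lemma adj_third (h : Hex G f w) {i : Fin 6} {y : V} (hy : G.Adj (f i) y)
    (hi : y ∉ Set.range f) : y = w i := by
  rcases h.nbr i y hy with h1 | h1 | h1
  · exact absurd ⟨_, h1.symm⟩ hi
  · exact absurd ⟨_, h1.symm⟩ hi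
  · exact h1

lemma mem_cls_self (h : Hex G f w) (i : Fin 6) : i ∈ cls G f w i := by
  by_cases hi : w i ∈ Set.range f
  · exact (mem_cls_in hi).2 (Or.inl rfl)
  · exact (mem_cls_out hi).2 (h.adj_of_out hi)

lemma chord_symm (h : Hex G f w) {i j : Fin 6} (hij : f j = w i) : w j = f i := by
  rcases h.third i with h1 | h1
  · have ha : G.Adj (f j) (f i) := by rw [hij]; exact h1.1.symm
    rcases h.nbr j _ ha with h2 | h2 | h2
    · exact absurd (by rw [← hij, h.inj h2, add_sub_cancel_right]) h1.2.2
    · exact absurd (by rw [← hij, h.inj h2, sub_add_cancel]) h1.2.1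
    · exact h2.symm
  · have : j = i := h.inj (hij.trans h1)
    rw [this, h1]

lemma third_eq (h : Hex G f w) {i j : Fin 6} (hj : j ∈ cls G f w i) (hi : w i ∉ Set.range f) :
    w j = w i :=
  (h.adj_third ((mem_cls_out hi).1 hj) hi).symm

lemma mem_range_iff (h : Hex G f w) {i j : Fin 6} (hj : j ∈ cls G f w i) :
    w j ∈ Set.range f ↔ w i ∈ Set.range f := by
  by_cases hi : w i ∈ Set.range f
  · refine iff_of_true ?_ hi
    rcases (mem_cls_in hi).1 hj with h1 | h1
    · rwa [h.inj h1]
    · exact ⟨i, (h.chord_symm h1).symm⟩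
  · rw [h.third_eq hj hi]

lemma kd_out (h : Hex G f w) {i : Fin 6} (hi : w i ∉ Set.range f) :
    kd G f w i = if (G.neighborSet (w i) ∩ Set.range f).ncard = 1 then
      (if (G.neighborSet (w i) \ Set.range f).ncard = 2 then 5 else 4)
    else if (G.neighborSet (w i) ∩ Set.range f).ncard = 2 then
      (if (G.neighborSet (w i) \ Set.range f).ncard = 0 then 0 else 1) else 2 := by
  unfold kd kind
  rw [if_neg (not_not.2 (h.adj_of_out hi)), if_neg hi]

open Classical in
lemma kd_in {i : Fin 6} (hi : w i ∈ Set.range f) :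
    kd G f w i = if G.Adj (f i) (w i) then 3 else 5 := by
  unfold kd kind
  rw [if_pos hi]
  split_ifs <;> rfl

lemma cls_eq (h : Hex G f w) {i j : Fin 6} (hj : j ∈ cls G f w i) : cls G f w j = cls G f w i := by
  have hr := h.mem_range_iff hj
  by_cases hi : w i ∈ Set.range f
  · ext k
    rw [mem_cls_in hi, mem_cls_in (hr.2 hi)]
    rcases (mem_cls_in hi).1 hj with h1 | h1
    · rw [h.inj h1]
    · rw [h.chord_symm h1, ← h1, or_comm]
  · ext k
    rw [mem_cls_out hi, mem_cls_out (mt hr.1 hi), h.third_eq hj hi]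

lemma kd_eq (h : Hex G f w) {i j : Fin 6} (hj : j ∈ cls G f w i) : kd G f w j = kd G f w i := by
  have hr := h.mem_range_iff hj
  by_cases hi : w i ∈ Set.range f
  · rcases (mem_cls_in hi).1 hj with h1 | h1
    · rw [h.inj h1]
    · rw [kd_in hi, kd_in (hr.2 hi), h.chord_symm h1, ← h1, G.adj_comm]
  · rw [h.kd_out hi, h.kd_out (mt hr.1 hi), h.third_eq hj hi]

lemma out_of_kd {i : Fin 6} (hi : kd G f w i = 1 ∨ kd G f w i = 4) :
    w i ∉ Set.range f := by
  intro hr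
  rw [kd_in hr] at hi
  split_ifs at hi <;> omega

lemma link_eq (h : Hex G f w) {i j : Fin 6} (hj : j ∈ cls G f w i) :
    link G f w j = link G f w i := by
  ext k
  rw [mem_link, mem_link, h.kd_eq hj]
  refine and_congr_right fun hk => ?_
  rw [h.third_eq hj (out_of_kd hk)]

lemma sig_eq (h : Hex G f w) {i j : Fin 6} (hj : j ∈ cls G f w i) : sig G f w j = sig G f w i := by
  rw [sig, sig, h.kd_eq hj, h.cls_eq hj, h.link_eq hj]

lemma link_symm {i j : Fin 6} (hj : j ∈ link G f w i) : i ∈ link G f w j := by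
  rw [mem_link] at hj ⊢
  exact ⟨hj.2.1, hj.1, hj.2.2.symm⟩

lemma card_inner (h : Hex G f w) {i : Fin 6} (hi : w i ∉ Set.range f) :
    (G.neighborSet (w i) ∩ Set.range f).ncard = (cls G f w i).card := by
  have : G.neighborSet (w i) ∩ Set.range f = f '' (cls G f w i : Set (Fin 6)) := by
    ext y
    constructor
    · rintro ⟨hy, j, rfl⟩
      exact ⟨j, (mem_cls_out hi).2 (G.adj_symm hy), rfl⟩
    · rintro ⟨j, hj, rfl⟩
      exact ⟨G.adj_symm ((mem_cls_out hi).1 hj), j, rfl⟩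
  rw [this, Set.ncard_image_of_injective _ h.inj, Set.ncard_coe_finset]

variable [Finite V]

lemma inner_add_outer (u : V) (S : Set V) :
    (G.neighborSet u ∩ S).ncard + (G.neighborSet u \ S).ncard = (G.neighborSet u).ncard :=
  Set.ncard_inter_add_ncard_sdiff_eq_ncard _ _ (Set.toFinite _)

lemma card_out (h : Hex G f w) (hG : Subcubic G) {i : Fin 6} (hi : w i ∉ Set.range f) :
    1 ≤ (cls G f w i).card ∧
      (cls G f w i).card + (G.neighborSet (w i) \ Set.range f).ncard ≤ 3 := by
  refine ⟨Finset.card_pos.2 ⟨i, h.mem_cls_self i⟩, ?_⟩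
  rw [← h.card_inner hi, inner_add_outer]
  exact hG _

lemma outer_le (h : Hex G f w) (hG : Subcubic G) {i : Fin 6} (hi : w i ∉ Set.range f) :
    (G.neighborSet (w i) \ Set.range f).ncard ≤ outDeg (kd G f w i) := by
  obtain ⟨h1, h2⟩ := h.card_out hG hi
  rw [h.kd_out hi, h.card_inner hi]
  have e0 : outDeg 0 = 0 := rfl
  have e1 : outDeg 1 = 1 := rfl
  have e2 : outDeg 2 = 0 := rfl
  have e4 : outDeg 4 = 1 := rfl
  have e5 : outDeg 5 = 2 := rfl
  split_ifs <;> omega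

lemma card_cls (h : Hex G f w) (hG : Subcubic G) (i : Fin 6) :
    (cls G f w i).card = entry [2, 2, 3, 2, 1, 1] (kd G f w i) := by
  have e0 : entry [2, 2, 3, 2, 1, 1] 0 = 2 := rfl
  have e1 : entry [2, 2, 3, 2, 1, 1] 1 = 2 := rfl
  have e2 : entry [2, 2, 3, 2, 1, 1] 2 = 3 := rfl
  have e3 : entry [2, 2, 3, 2, 1, 1] 3 = 2 := rfl
  have e4 : entry [2, 2, 3, 2, 1, 1] 4 = 1 := rfl
  have e5 : entry [2, 2, 3, 2, 1, 1] 5 = 1 := rfl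
  by_cases hi : w i ∈ Set.range f
  · rw [kd_in hi]
    obtain ⟨j, hj⟩ := hi
    have hc : cls G f w i = {i, j} := by
      ext k
      rw [mem_cls_in ⟨j, hj⟩, ← hj, h.inj.eq_iff, h.inj.eq_iff]
      simp
    rw [hc]
    split_ifs with ha
    · rw [e3, Finset.card_pair]
      rintro rfl
      rw [← hj] at ha
      exact G.loopless.irrefl _ ha
    · have : j = i := by
        rcases h.third i with h1 | h1
        · exact absurd h1.1 ha
        · exact h.inj (hj.trans h1)
      rw [this, e5]
      simp
  · obtain ⟨h1, h2⟩ := h.card_out hG hi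
    rw [h.kd_out hi, h.card_inner hi]
    split_ifs <;> omega

lemma outer_unique (h : Hex G f w) (hG : Subcubic G) {i : Fin 6}
    (hi : kd G f w i = 1 ∨ kd G f w i = 4) {y z : V} (hy : G.Adj (w i) y) (hz : G.Adj (w i) z)
    (hyf : y ∉ Set.range f) (hzf : z ∉ Set.range f) : y = z := by
  have h1 := h.outer_le hG (out_of_kd hi)
  have h2 : outDeg (kd G f w i) = 1 := by rcases hi with e | e <;> rw [e] <;> rfl
  rw [h2] at h1
  exact Set.ncard_le_one (Set.toFinite _) |>.1 h1 y ⟨hy, hyf⟩ z ⟨hz, hzf⟩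

lemma link_eq_cls (h : Hex G f w) (hG : Subcubic G) {i j : Fin 6} (hj : j ∈ link G f w i) :
    link G f w i = cls G f w j := by
  rw [mem_link] at hj
  ext k
  rw [mem_link, mem_cls_out (out_of_kd hj.2.1)]
  constructor
  · rintro ⟨-, hk, ha⟩
    rw [h.outer_unique hG hj.1 hj.2.2 ha (out_of_kd hj.2.1) (out_of_kd hk)]
    exact h.adj_of_out (out_of_kd hk)
  · intro ha
    have hk : k ∈ cls G f w j := (mem_cls_out (out_of_kd hj.2.1)).2 ha
    refine ⟨hj.1, by rw [h.kd_eq hk]; exact hj.2.1, ?_⟩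
    rw [h.third_eq hk (out_of_kd hj.2.1)]
    exact hj.2.2

end Hex

end Hexagons

section Signatures

variable {V : Type} {G : SimpleGraph V} {f w : Fin 6 → V}

lemma enc_and_eq_zero {s t : Finset (Fin 6)} : enc s &&& enc t = 0 ↔ Disjoint s t := by
  rw [Finset.disjoint_left]
  constructor
  · intro h j hs ht
    exact and_ne_zero_of_testBit (i := j) (by simpa [testBit_enc] using hs)
      (by simpa [testBit_enc] using ht) h
  · intro h
    refine Nat.eq_of_testBit_eq fun j => ?_
    rw [Nat.testBit_and, Nat.zero_testBit]
    by_cases hj : j < 6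
    · have h1 := testBit_enc s ⟨j, hj⟩
      have h2 := testBit_enc t ⟨j, hj⟩
      simp only at h1 h2
      rw [h1, h2, ← Bool.decide_and, decide_eq_false_iff_not]
      exact fun h3 => h h3.1 h3.2
    · rw [Nat.testBit_lt_two_pow (lt_of_lt_of_le (enc_lt s)
        (Nat.pow_le_pow_right (n := 2) (by norm_num) (not_lt.1 hj)))]
      rfl

lemma enc_injective : Function.Injective enc := by
  intro s t hst
  ext j
  have h1 := testBit_enc s j
  rw [hst, testBit_enc] at h1
  exact (decide_eq_decide.1 h1).symm

lemma enc_eq_zero {s : Finset (Fin 6)} : enc s = 0 ↔ s = ∅ := by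
  rw [← enc_injective.eq_iff]
  rfl

lemma mem_codes {i t m l : ℕ} {tags : List ℕ} (ht : t ∈ tags) (hm : m < 64) (hl : l < 64)
    (h1 : maskOk i t m = true) (h2 : linkOk t m l = true) : code t m l ∈ codes i tags := by
  have hf : ∀ p : ℕ → Bool, recFilter p masks = masks.filter p := fun p => recFilter_eq p _
  simp only [codes, recFlatMap_eq, hf, recMap_eq, force_eq, List.mem_flatMap, List.mem_map,
    List.mem_filter]
  exact ⟨t, ht, m, ⟨List.mem_range.2 hm, h1⟩, l, ⟨List.mem_range.2 hl, h2⟩, rfl⟩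

lemma spread_two_pow (i j : Fin 6) (h0 : j ≠ i) (h1 : j ≠ i + 1) (h2 : j ≠ i - 1) :
    spread (2 ^ (i : ℕ)) &&& (enc {i, j} - 2 ^ (i : ℕ)) = 0 := by
  revert i j
  decide +kernel

namespace Hex

lemma tagOf_sig (i : Fin 6) : tagOf (sig G f w i) = kd G f w i :=
  tagOf_code (by have := kd_le (G := G) (f := f) (w := w) i; omega)

lemma maskOf_sig (i : Fin 6) : maskOf (sig G f w i) = enc (cls G f w i) :=
  maskOf_code (by have := kd_le (G := G) (f := f) (w := w) i; omega) (enc_lt _)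

lemma linkOf_sig (i : Fin 6) : linkOf (sig G f w i) = enc (link G f w i) :=
  linkOf_code (by have := kd_le (G := G) (f := f) (w := w) i; omega) (enc_lt _)

lemma entry_sigs (i : Fin 6) : entry (sigs G f w) i = sig G f w i := by
  fin_cases i <;> rfl

lemma disjoint_cls (h : Hex G f w) {i j : Fin 6} (hij : cls G f w i ≠ cls G f w j) :
    Disjoint (cls G f w i) (cls G f w j) := by
  rw [Finset.disjoint_left]
  intro k hi hj
  exact hij ((h.cls_eq hi).symm.trans (h.cls_eq hj))

/-- A third edge inside the cycle is a long diagonal or cuts off a `4`-cycle or a triangle. -/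
lemma exists_chord (h : Hex G f w) {i : Fin 6} (hi : kd G f w i = 3) :
    ∃ j, f j = w i ∧ cls G f w i = {i, j} ∧ j ≠ i ∧ j ≠ i + 1 ∧ j ≠ i - 1 := by
  have hr : w i ∈ Set.range f := by
    by_contra hr
    rw [h.kd_out hr] at hi
    split_ifs at hi <;> omega
  rw [kd_in hr] at hi
  have ha : G.Adj (f i) (w i) := by
    split_ifs at hi with ha
    · exact ha
    · omega
  obtain ⟨j, hj⟩ := hr
  refine ⟨j, hj, ?_, ?_, ?_, ?_⟩
  · ext k
    rw [mem_cls_in ⟨j, hj⟩, ← hj, h.inj.eq_iff, h.inj.eq_iff]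
    simp
  · rintro rfl
    rw [← hj] at ha
    exact G.loopless.irrefl _ ha
  · rintro rfl
    rcases h.third i with h1 | h1
    · exact h1.2.1 hj.symm
    · rw [h1] at ha
      exact G.loopless.irrefl _ ha
  · rintro rfl
    rcases h.third i with h1 | h1
    · exact h1.2.2 hj.symm
    · rw [h1] at ha
      exact G.loopless.irrefl _ ha

lemma outDeg_eq_one_iff (i : Fin 6) :
    outDeg (kd G f w i) = 1 ↔ kd G f w i = 1 ∨ kd G f w i = 4 := by
  have : ∀ t : Fin 6, outDeg t = 1 ↔ (t : ℕ) = 1 ∨ (t : ℕ) = 4 := by decide +kernel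
  exact this ⟨kd G f w i, by have := kd_le (G := G) (f := f) (w := w) i; omega⟩

variable [Finite V]

lemma maskOk_sig (h : Hex G f w) (hG : Subcubic G) (i : Fin 6) :
    maskOk i (kd G f w i) (enc (cls G f w i)) = true := by
  have e1 : Nat.beq (weight6 (enc (cls G f w i))) (entry [2, 2, 3, 2, 1, 1] (kd G f w i)) =
      true := by
    rw [weight6_enc, h.card_cls hG, Nat.beq_refl]
  have e2 : testB (enc (cls G f w i)) i = true := by
    rw [testB_eq, testBit_enc]
    exact decide_eq_true (h.mem_cls_self i)
  unfold maskOk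
  rw [e1, e2, cond_true, cond_true]
  by_cases h3 : kd G f w i = 3
  · obtain ⟨j, -, hc, h0, h1, h2⟩ := h.exists_chord h3
    rw [isZero_eq, hc]
    have := spread_two_pow i j h0 h1 h2
    rw [show Nat.land (spread (Nat.pow 2 i)) (Nat.sub (enc {i, j}) (Nat.pow 2 i)) = 0 from this]
    cases Nat.beq (kd G f w i) 3 <;> rfl
  · rw [Bool.eq_false_iff.2 fun h4 => h3 (Nat.eq_of_beq_eq_true h4)]
    rfl

lemma link_card_le (h : Hex G f w) (hG : Subcubic G) (i : Fin 6) : (link G f w i).card ≤ 2 := by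
  rcases (link G f w i).eq_empty_or_nonempty with h0 | ⟨j, hj⟩
  · simp [h0]
  · rw [h.link_eq_cls hG hj, h.card_cls hG]
    rcases (mem_link.1 hj).2.1 with e | e <;> rw [e]
    · exact le_refl 2
    · exact one_le_two

lemma linkOk_sig (h : Hex G f w) (hG : Subcubic G) (i : Fin 6) :
    linkOk (kd G f w i) (enc (cls G f w i)) (enc (link G f w i)) = true := by
  unfold linkOk
  by_cases h1 : outDeg (kd G f w i) = 1
  · have h2 := (outDeg_eq_one_iff i).1 h1
    have e2 : Nat.ble (weight6 (enc (link G f w i))) 2 = true := by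
      rw [weight6_enc, Nat.ble_eq]
      exact h.link_card_le hG i
    rw [h1, e2, isZero_eq]
    refine decide_eq_true (enc_and_eq_zero.2 (Finset.disjoint_left.2 fun j hj hc => ?_))
    have := (mem_link.1 hj).2.2
    rw [h.third_eq hc (out_of_kd h2)] at this
    exact G.loopless.irrefl _ this
  · rw [Bool.eq_false_iff.2 fun h4 => h1 (Nat.eq_of_beq_eq_true h4), cond_false, isZero_eq]
    refine decide_eq_true (enc_eq_zero.2 (Finset.eq_empty_of_forall_notMem fun j hj => ?_))
    exact h1 ((outDeg_eq_one_iff i).2 (mem_link.1 hj).1)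

lemma sig_mem_codes (h : Hex G f w) (hG : Subcubic G) (i : Fin 6) {tags : List ℕ}
    (ht : kd G f w i ∈ tags) : sig G f w i ∈ codes i tags :=
  mem_codes ht (enc_lt _) (enc_lt _) (h.maskOk_sig hG i) (h.linkOk_sig hG i)

lemma compat_sig (h : Hex G f w) (hG : Subcubic G) (i j : Fin 6) :
    compat (sig G f w i) (sig G f w j) = true := by
  by_cases hs : sig G f w i = sig G f w j
  · unfold compat
    rw [hs, Nat.beq_refl]
    rfl
  have hc : cls G f w i ≠ cls G f w j := fun hc =>
    hs (h.sig_eq (hc ▸ h.mem_cls_self i))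
  have e : compat (sig G f w i) (sig G f w j) =
    cond (Nat.beq (sig G f w i) (sig G f w j)) true
    (cond (isZero (maskOf (sig G f w i) &&& maskOf (sig G f w j)))
      (cond (isZero (linkOf (sig G f w i) &&& maskOf (sig G f w j)))
        (isZero (linkOf (sig G f w j) &&& maskOf (sig G f w i)))
        (cond (Nat.beq (linkOf (sig G f w i)) (maskOf (sig G f w j)))
          (Nat.beq (linkOf (sig G f w j)) (maskOf (sig G f w i))) false)) false) := rfl
  have key : ∀ i j, ¬Disjoint (link G f w i) (cls G f w j) →
      link G f w i = cls G f w j ∧ link G f w j = cls G f w i := by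
    intro i j hd
    obtain ⟨k, hk, hkj⟩ := Finset.not_disjoint_iff.1 hd
    have h1 : link G f w i = cls G f w j := (h.link_eq_cls hG hk).trans (h.cls_eq hkj)
    refine ⟨h1, h.link_eq_cls hG (link_symm ?_)⟩
    rw [h1]
    exact h.mem_cls_self j
  rw [e, Bool.eq_false_iff.2 fun h4 => hs (Nat.eq_of_beq_eq_true h4), cond_false]
  simp only [isZero_eq, maskOf_sig, linkOf_sig, enc_and_eq_zero]
  rw [decide_eq_true (h.disjoint_cls hc), cond_true]
  by_cases hd : Disjoint (link G f w i) (cls G f w j)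
  · rw [decide_eq_true hd, cond_true]
    refine decide_eq_true ?_
    by_contra hd'
    obtain ⟨h1, h2⟩ := key j i hd'
    rw [h2] at hd
    exact Finset.disjoint_left.1 hd (h.mem_cls_self j) (h.mem_cls_self j)
  · obtain ⟨h1, h2⟩ := key i j hd
    rw [decide_eq_false hd, h1, h2, Nat.beq_refl, Nat.beq_refl]
    rfl

end Hex

end Signatures

section Symmetry

variable {V : Type} {G : SimpleGraph V} {f w : Fin 6 → V}

/-- The rank of a cycle together with its third neighbours. -/
noncomputable def rk (G : SimpleGraph V) (f w : Fin 6 → V) : ℕ :=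
  rank fun i => tagOf (entry (sigs G f w) i)

lemma rank_eq (a : ℕ → ℕ) :
    rank a = a 5 + 6 * (a 4 + 6 * (a 3 + 6 * (a 2 + 6 * (a 1 + 6 * a 0)))) := rfl

lemma rank_congr {a b : ℕ → ℕ} (h : ∀ i : Fin 6, a i = b i) : rank a = rank b := by
  rw [rank_eq, rank_eq]
  have h0 : a 0 = b 0 := h 0
  have h1 : a 1 = b 1 := h 1
  have h2 : a 2 = b 2 := h 2
  have h3 : a 3 = b 3 := h 3
  have h4 : a 4 = b 4 := h 4
  have h5 : a 5 = b 5 := h 5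
  rw [h0, h1, h2, h3, h4, h5]

lemma kd_shift (i j : Fin 6) :
    kd G (fun i => f (i + j)) (fun i => w (i + j)) i = kd G f w (i + j) := by
  have : Set.range (fun i => f (i + j)) = Set.range f :=
    (Equiv.addRight j).surjective.range_comp f
  unfold kd
  rw [this]

lemma kd_reflect (i j : Fin 6) :
    kd G (fun i => f (j - i)) (fun i => w (j - i)) i = kd G f w (j - i) := by
  have : Set.range (fun i => f (j - i)) = Set.range f :=
    (Equiv.subLeft j).surjective.range_comp f
  unfold kd
  rw [this]

lemma rk_shift (j : Fin 6) : rk G (fun i => f (i + j)) (fun i => w (i + j)) =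
    rank fun i => tagOf (entry (sigs G f w) (Nat.mod (Nat.add i j) 6)) := by
  refine rank_congr fun i => ?_
  have : Nat.mod (Nat.add i j) 6 = ((i + j : Fin 6) : ℕ) := rfl
  rw [this, Hex.entry_sigs, Hex.entry_sigs, Hex.tagOf_sig, Hex.tagOf_sig, kd_shift]

lemma rk_reflect (j : Fin 6) : rk G (fun i => f (j - i)) (fun i => w (j - i)) =
    rank fun i => tagOf (entry (sigs G f w) (Nat.mod (Nat.sub (Nat.add 6 j) i) 6)) := by
  refine rank_congr fun i => ?_
  have : Nat.mod (Nat.sub (Nat.add 6 j) i) 6 = ((j - i : Fin 6) : ℕ) := by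
    revert i j
    decide
  rw [this, Hex.entry_sigs, Hex.entry_sigs, Hex.tagOf_sig, Hex.tagOf_sig, kd_reflect]

lemma kd_le_of_rk_le {j : Fin 6}
    (h : rk G (fun i => f (i + j)) (fun i => w (i + j)) ≤ rk G f w) : kd G f w j ≤ kd G f w 0 := by
  have e : ∀ (f w : Fin 6 → V) (i : Fin 6), tagOf (entry (sigs G f w) i) = kd G f w i :=
    fun f w i => by rw [Hex.entry_sigs, Hex.tagOf_sig]
  rw [rk, rk, rank_eq, rank_eq] at h
  have h0 := e (fun i => f (i + j)) (fun i => w (i + j)) 0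
  rw [kd_shift, zero_add] at h0
  have e0 := e f w 0
  have e1 := (e f w 1).trans_le (kd_le 1)
  have e2 := (e f w 2).trans_le (kd_le 2)
  have e3 := (e f w 3).trans_le (kd_le 3)
  have e4 := (e f w 4).trans_le (kd_le 4)
  have e5 := (e f w 5).trans_le (kd_le 5)
  simp only [Fin.isValue, Fin.val_zero, Fin.val_one, Fin.val_two] at h0 e0 e1 e2
  change tagOf (entry (sigs G f w) 3) ≤ 5 at e3
  change tagOf (entry (sigs G f w) 4) ≤ 5 at e4
  change tagOf (entry (sigs G f w) 5) ≤ 5 at e5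
  omega

lemma dominated_eq_false
    (h1 : ∀ j : Fin 6, rk G (fun i => f (i + j)) (fun i => w (i + j)) ≤ rk G f w)
    (h2 : ∀ j : Fin 6, rk G (fun i => f (j - i)) (fun i => w (j - i)) ≤ rk G f w) :
    dominated (sigs G f w) = false := by
  simp only [dominated, force_eq, recAny_eq]
  rw [Bool.eq_false_iff, Ne, List.any_eq_true]
  rintro ⟨j, hj, hj'⟩
  have hj6 : j < 6 := by
    simp only [List.mem_cons, List.not_mem_nil, or_false] at hj
    omega
  have e1 := h1 ⟨j, hj6⟩
  have e2 := h2 ⟨j, hj6⟩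
  rw [rk_shift] at e1
  rw [rk_reflect] at e2
  have f1 := Bool.eq_false_iff.2 fun h => e1.not_gt (Nat.blt_eq.mp h)
  have f2 := Bool.eq_false_iff.2 fun h => e2.not_gt (Nat.blt_eq.mp h)
  unfold rk at f1 f2
  simp only at f1 f2 hj'
  rw [f1, f2] at hj'
  exact Bool.false_ne_true hj'

lemma exists_attempt_of_colorable {cs : List ℕ} (h : colorable cs = true) :
    ∃ order dp, attempt cs order dp = true := by
  have key : ∀ a b c : Bool, cond a true (cond b true c) = true →
      a = true ∨ b = true ∨ c = true := by decide
  rcases key _ _ _ h with h1 | h1 | h1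
  · exact ⟨_, _, h1⟩
  · exact ⟨_, _, h1⟩
  · exact ⟨_, _, h1⟩

theorem exists_attempt [Finite V] (hc : ∀ t ≤ 5, colorableAll t = true) (h : Hex G f w)
    (hG : Subcubic G)
    (h1 : ∀ j : Fin 6, rk G (fun i => f (i + j)) (fun i => w (i + j)) ≤ rk G f w)
    (h2 : ∀ j : Fin 6, rk G (fun i => f (j - i)) (fun i => w (j - i)) ≤ rk G f w) :
    ∃ order dp, attempt (sigs G f w) order dp = true := by
  have hs : ∀ i : Fin 6, kd G f w i ∈ List.range (Nat.succ (kd G f w 0)) := fun i =>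
    List.mem_range.2 (Nat.lt_succ_of_le (kd_le_of_rk_le (h1 i)))
  have h0 : search (fun cs => cond (dominated cs) true (colorable cs)) 6
      [codes 0 [kd G f w 0], codes 1 (List.range (Nat.succ (kd G f w 0))),
        codes 2 (List.range (Nat.succ (kd G f w 0))), codes 3 (List.range (Nat.succ (kd G f w 0))),
        codes 4 (List.range (Nat.succ (kd G f w 0))),
        codes 5 (List.range (Nat.succ (kd G f w 0)))] [] = true := hc _ (kd_le 0)
  have := search_sound _ [] h0 (sigs G f w)
    (.cons (h.sig_mem_codes hG 0 (List.mem_singleton_self _)) <|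
      .cons (h.sig_mem_codes hG 1 (hs 1)) <| .cons (h.sig_mem_codes hG 2 (hs 2)) <|
      .cons (h.sig_mem_codes hG 3 (hs 3)) <| .cons (h.sig_mem_codes hG 4 (hs 4)) <|
      .cons (h.sig_mem_codes hG 5 (hs 5)) .nil)
    (by
      refine List.pairwise_of_forall_mem_list fun a ha b hb => ?_
      have hm : ∀ a ∈ sigs G f w, ∃ i, a = sig G f w i := by
        intro a ha
        simp only [sigs, List.mem_cons, List.not_mem_nil, or_false] at ha
        rcases ha with rfl | rfl | rfl | rfl | rfl | rfl <;> exact ⟨_, rfl⟩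
      obtain ⟨i, rfl⟩ := hm a ha
      obtain ⟨j, rfl⟩ := hm b hb
      exact h.compat_sig hG i j)
  rw [List.nil_append, dominated_eq_false h1 h2, cond_false] at this
  exact exists_attempt_of_colorable this

end Symmetry

section Positions

variable {V : Type} {G : SimpleGraph V} {f w : Fin 6 → V}

/-- Edge number `k`: for `k < 6` an edge of the cycle, for `6 ≤ k` an edge to a third neighbour. -/
def edgeAt (f w : Fin 6 → V) (k : ℕ) : Sym2 V :=
  s(f (Fin.ofNat 6 k), if k < 6 then f (Fin.ofNat 6 k + 1) else w (Fin.ofNat 6 k))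

/-- Bit `b` stands for the vertex `a`. -/
def Marks (f w : Fin 6 → V) (b : ℕ) (a : V) : Prop :=
  (∃ i : Fin 6, b = i ∧ a = f i) ∨ ∃ i : Fin 6, b = 6 + i ∧ a = w i ∧ w i ∉ Set.range f

lemma edgeAt_side (i : Fin 6) : edgeAt f w i = s(f i, f (i + 1)) := by
  rw [edgeAt, if_pos i.isLt, Fin.ofNat_val_eq_self]

lemma edgeAt_spoke (i : Fin 6) : edgeAt f w (6 + i) = s(f i, w i) := by
  have : Fin.ofNat 6 (6 + i) = i := by
    revert i
    decide
  rw [edgeAt, if_neg (by omega), this]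

lemma side_or_spoke {k : ℕ} (hk : k < 12) : ∃ i : Fin 6, k = i ∨ k = 6 + i := by
  by_cases h : k < 6
  · exact ⟨⟨k, h⟩, Or.inl rfl⟩
  · exact ⟨⟨k - 6, by omega⟩, Or.inr (by simp only; omega)⟩

lemma ends_side (cs : List ℕ) (i : Fin 6) : ends cs i = enc {i, i + 1} := by
  have e : ends cs i = cond (Nat.ble i 5) (2 ^ (i : ℕ) ||| 2 ^ succ6 i)
    (2 ^ ((i : ℕ) - 6) ||| tip (entry cs ((i : ℕ) - 6))) := rfl
  rw [e, Nat.ble_eq_true_of_le (by omega), cond_true]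
  clear e
  revert i
  decide +kernel

lemma ble_spoke (i : Fin 6) : Nat.ble (6 + i) 5 = false := by
  revert i
  decide

lemma sub_spoke (i : Fin 6) : Nat.sub (6 + i) 6 = i := Nat.add_sub_cancel_left ..

lemma succ6_val (i : Fin 6) : succ6 i = ((i + 1 : Fin 6) : ℕ) := by
  revert i
  decide +kernel

namespace Hex

lemma tip_sig (i : Fin 6) : tip (sig G f w i) =
    if kd G f w i = 3 then enc (cls G f w i) else enc (cls G f w i) <<< 6 := by
  have e : tip (sig G f w i) = cond (Nat.beq (tagOf (sig G f w i)) 3) (maskOf (sig G f w i))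
    (maskOf (sig G f w i) <<< 6) := rfl
  rw [e, natBeq_eq_decide, tagOf_sig, maskOf_sig]
  split_ifs with h <;> simp [h]

lemma ends_spoke (i : Fin 6) :
    ends (sigs G f w) (6 + i) = 2 ^ (i : ℕ) ||| tip (sig G f w i) := by
  unfold ends
  rw [ble_spoke, cond_false, sub_spoke, entry_sigs]
  rfl

lemma hood_side (i : Fin 6) : hood (sigs G f w) i = spread (enc {i, i + 1}) |||
    (tip (sig G f w i) ||| tip (sig G f w (i + 1))) := by
  have e : Nat.lor (Nat.pow 2 i) (Nat.pow 2 ((i + 1 : Fin 6) : ℕ)) = enc {i, i + 1} := by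
    revert i
    decide +kernel
  unfold hood
  rw [Nat.ble_eq_true_of_le (by omega), cond_true, succ6_val, e, entry_sigs, entry_sigs]
  rfl

lemma hood_spoke (i : Fin 6) : hood (sigs G f w) (6 + i) =
    if kd G f w i = 3 then spread (enc (cls G f w i)) else spread (enc {i}) |||
      (enc (cls G f w i) ||| (enc (cls G f w i) ||| enc (link G f w i)) <<< 6) := by
  have e : Nat.pow 2 i = enc {i} := by
    revert i
    decide +kernel
  unfold hood
  rw [ble_spoke, cond_false, sub_spoke, entry_sigs, e]
  simp only [natBeq_eq_decide, tagOf_sig, maskOf_sig, linkOf_sig]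
  split_ifs with h
  · rw [decide_eq_true h, cond_true]
  · rw [decide_eq_false h, cond_false]
    rfl

lemma present_spoke (i : Fin 6) : present (sigs G f w) (6 + i) = true ↔
    kd G f w i ≠ 5 ∧ (kd G f w i = 3 → enc (cls G f w i) < 2 ^ ((i : ℕ) + 1)) := by
  have e : Nat.pow 2 (Nat.sub (6 + i) 5) = 2 ^ ((i : ℕ) + 1) := by
    rw [show Nat.sub (6 + i) 5 = (i : ℕ) + 1 from by simp only [Nat.sub_eq]; omega]
    rfl
  unfold present
  rw [ble_spoke, cond_false, sub_spoke, entry_sigs, e]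
  simp only [natBeq_eq_decide, tagOf_sig, maskOf_sig]
  by_cases h5 : kd G f w i = 5
  · simp [h5]
  · by_cases h3 : kd G f w i = 3
    · simp [h3, Nat.blt_eq]
    · simp [h3, h5]

lemma present_side (i : Fin 6) : present (sigs G f w) i = true := by
  unfold present
  rw [Nat.ble_eq_true_of_le (by omega)]
  rfl

lemma testBit_tip {i j : Fin 6} (hj : j ∈ cls G f w i) :
    (tip (sig G f w i)).testBit (if kd G f w i = 3 then j else 6 + j) = true := by
  rw [tip_sig]
  split_ifs with h
  · simpa [testBit_enc] using hj
  · rw [Nat.testBit_shiftLeft, Nat.add_sub_cancel_left, testBit_enc]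
    simpa using hj

lemma kd_eq_three_iff (h : Hex G f w) {i : Fin 6} :
    kd G f w i = 3 ↔ G.Adj (f i) (w i) ∧ w i ∈ Set.range f := by
  by_cases hi : w i ∈ Set.range f
  · rw [kd_in hi]
    split_ifs with ha <;> simp [ha, hi]
  · rw [h.kd_out hi]
    split_ifs <;> simp [hi]

lemma eq_of_marks (h : Hex G f w) {i : Fin 6} {b : ℕ} (hb : Marks f w b (f i)) : b = i := by
  rcases hb with ⟨j, rfl, hj⟩ | ⟨j, rfl, hj, hj'⟩
  · rw [h.inj hj]
  · exact absurd ⟨i, hj⟩ hj'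

lemma exists_marks {k : ℕ} (hk : k < 12) {a : V} (ha : a ∈ edgeAt f w k) : ∃ b, Marks f w b a := by
  have hf : ∀ i, ∃ b, Marks f w b (f i) := fun i => ⟨i, Or.inl ⟨i, rfl, rfl⟩⟩
  obtain ⟨i, rfl | rfl⟩ := side_or_spoke hk
  · rw [edgeAt_side, Sym2.mem_iff] at ha
    rcases ha with rfl | rfl
    · exact hf _
    · exact hf _
  · rw [edgeAt_spoke, Sym2.mem_iff] at ha
    rcases ha with rfl | rfl
    · exact hf _
    · by_cases hi : w i ∈ Set.range f
      · obtain ⟨j, hj⟩ := hi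
        rw [← hj]
        exact hf j
      · exact ⟨6 + i, Or.inr ⟨i, rfl, rfl, hi⟩⟩

/-- A mark of the third neighbour of `f i` is a bit of the tip. -/
lemma testBit_tip_of_marks (h : Hex G f w) {i : Fin 6} {b : ℕ} (ha : G.Adj (f i) (w i))
    (hb : Marks f w b (w i)) : (tip (sig G f w i)).testBit b = true := by
  rcases hb with ⟨j, rfl, hj⟩ | ⟨j, rfl, hj, hj'⟩
  · have h3 : kd G f w i = 3 := h.kd_eq_three_iff.2 ⟨ha, j, hj.symm⟩
    have := testBit_tip (G := G) ((mem_cls_in ⟨j, hj.symm⟩).2 (Or.inr hj.symm))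
    rwa [if_pos h3] at this
  · have hi : w i ∉ Set.range f := hj ▸ hj'
    have h3 : kd G f w i ≠ 3 := fun h3 => hi (h.kd_eq_three_iff.1 h3).2
    have := testBit_tip (G := G) ((mem_cls_out hi).2 (hj ▸ h.adj_of_out hj'))
    rwa [if_neg h3] at this

lemma adj_of_kd (h : Hex G f w) {i : Fin 6} (h5 : kd G f w i ≠ 5) : G.Adj (f i) (w i) := by
  by_cases hi : w i ∈ Set.range f
  · rw [kd_in hi] at h5
    split_ifs at h5 with ha
    · exact ha
    · exact absurd rfl h5
  · exact h.adj_of_out hi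

lemma testBit_ends (h : Hex G f w) {k b : ℕ} {a : V} (hk : k < 12)
    (hp : present (sigs G f w) k = true) (ha : a ∈ edgeAt f w k) (hb : Marks f w b a) :
    (ends (sigs G f w) k).testBit b = true := by
  obtain ⟨i, rfl | rfl⟩ := side_or_spoke hk
  · rw [edgeAt_side, Sym2.mem_iff] at ha
    rw [ends_side]
    rcases ha with rfl | rfl
    · rw [h.eq_of_marks hb, testBit_enc]
      simp
    · rw [h.eq_of_marks hb, testBit_enc]
      simp
  · rw [edgeAt_spoke, Sym2.mem_iff] at ha
    rw [ends_spoke, Nat.testBit_or]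
    rcases ha with rfl | rfl
    · rw [h.eq_of_marks hb, Nat.testBit_two_pow_self]
      rfl
    · rw [h.testBit_tip_of_marks (h.adj_of_kd ((present_spoke i).1 hp).1) hb, Bool.or_true]

/-- Marks of the closed neighbourhood of `f i`. -/
lemma marks_nbr (h : Hex G f w) {i : Fin 6} {b : ℕ} {a : V} (hb : Marks f w b a)
    (ha : a = f i ∨ G.Adj a (f i)) :
    b = i ∨ b = ((i + 1 : Fin 6) : ℕ) ∨ b = ((i - 1 : Fin 6) : ℕ) ∨
      G.Adj (f i) (w i) ∧ a = w i := by
  rcases ha with rfl | ha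
  · exact Or.inl (h.eq_of_marks hb)
  · rcases h.nbr i a ha.symm with rfl | rfl | rfl
    · exact Or.inr (Or.inl (h.eq_of_marks hb))
    · exact Or.inr (Or.inr (Or.inl (h.eq_of_marks hb)))
    · exact Or.inr (Or.inr (Or.inr ⟨ha.symm, rfl⟩))

/-- A third neighbour with a neighbour off the cycle has kind `1`, `4` or `5`. -/
lemma kd_of_outer [Finite V] (h : Hex G f w) (hG : Subcubic G) {i : Fin 6}
    (hi : w i ∉ Set.range f) (h5 : kd G f w i ≠ 5) {y : V} (hy : G.Adj (w i) y)
    (hyf : y ∉ Set.range f) : kd G f w i = 1 ∨ kd G f w i = 4 := by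
  have h1 : 0 < (G.neighborSet (w i) \ Set.range f).ncard :=
    (Set.ncard_pos (Set.toFinite _)).2 ⟨y, hy, hyf⟩
  have h2 := h1.trans_le (h.outer_le hG hi)
  have : ∀ t : Fin 6, (t : ℕ) ≠ 5 → 0 < outDeg t → (t : ℕ) = 1 ∨ (t : ℕ) = 4 := by decide +kernel
  exact this ⟨kd G f w i, Nat.lt_succ_of_le (kd_le i)⟩ h5 h2

lemma testBit_hood [Finite V] (h : Hex G f w) (hG : Subcubic G) {k b : ℕ} {a a' : V} (hk : k < 12)
    (hp : present (sigs G f w) k = true) (ha : a' ∈ edgeAt f w k) (hb : Marks f w b a)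
    (haa : a = a' ∨ G.Adj a a') (h5 : ∀ j, a = w j → w j ∉ Set.range f → kd G f w j ≠ 5) :
    (hood (sigs G f w) k).testBit b = true := by
  obtain ⟨i, rfl | rfl⟩ := side_or_spoke hk
  · rw [edgeAt_side, Sym2.mem_iff] at ha
    rw [hood_side, Nat.testBit_or, Nat.testBit_or]
    rcases ha with rfl | rfl
    · rcases h.marks_nbr hb haa with rfl | rfl | rfl | ⟨h1, rfl⟩
      · rw [testBit_spread]; simp
      · rw [testBit_spread]; simp
      · rw [testBit_spread]; simp
      · rw [h.testBit_tip_of_marks h1 hb]; simp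
    · rcases h.marks_nbr hb haa with rfl | rfl | rfl | ⟨h1, rfl⟩
      · rw [testBit_spread]; simp
      · rw [testBit_spread]; simp
      · rw [testBit_spread]; simp
      · rw [h.testBit_tip_of_marks h1 hb]; simp
  · have h1 := (present_spoke i).1 hp
    have had := h.adj_of_kd h1.1
    rw [edgeAt_spoke, Sym2.mem_iff] at ha
    rw [hood_spoke]
    by_cases h3 : kd G f w i = 3
    · rw [if_pos h3]
      obtain ⟨m, hm, hc, -⟩ := h.exists_chord h3
      have hwm := h.chord_symm hm
      rw [hc]
      rcases ha with rfl | rfl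
      · rcases h.marks_nbr hb haa with rfl | rfl | rfl | ⟨-, rfl⟩
        · rw [testBit_spread]; simp
        · rw [testBit_spread]; simp
        · rw [testBit_spread]; simp
        · rw [← hm] at hb
          rw [h.eq_of_marks hb, testBit_spread]; simp
      · rw [← hm] at haa
        rcases h.marks_nbr hb haa with rfl | rfl | rfl | ⟨-, rfl⟩
        · rw [testBit_spread]; simp
        · rw [testBit_spread]; simp
        · rw [testBit_spread]; simp
        · rw [hwm] at hb
          rw [h.eq_of_marks hb, testBit_spread]; simp
    · have hi : w i ∉ Set.range f := fun hi => h3 (h.kd_eq_three_iff.2 ⟨had, hi⟩)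
      rw [if_neg h3]
      simp only [Nat.testBit_or, Nat.testBit_shiftLeft]
      have htip : Marks f w b (w i) →
          ((enc (cls G f w i)) <<< 6).testBit b = true := fun hb => by
        have := h.testBit_tip_of_marks had hb
        rwa [tip_sig, if_neg h3] at this
      rw [Nat.testBit_shiftLeft] at htip
      have htip' : Marks f w b (w i) → b ≥ 6 ∧ (enc (cls G f w i)).testBit (b - 6) = true :=
        fun hb => by simpa using htip hb
      rcases ha with rfl | rfl
      · rcases h.marks_nbr hb haa with rfl | rfl | rfl | ⟨-, rfl⟩
        · rw [testBit_spread]; simp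
        · rw [testBit_spread]; simp
        · rw [testBit_spread]; simp
        · simp [htip' hb]
      · rcases haa with rfl | haa
        · simp [htip' hb]
        · rcases hb with ⟨j, rfl, rfl⟩ | ⟨j, rfl, rfl, hj⟩
          · rw [testBit_enc (cls G f w i), decide_eq_true ((mem_cls_out hi).2 haa)]; simp
          · have hj1 : kd G f w j = 1 ∨ kd G f w j = 4 :=
              h.kd_of_outer hG hj (h5 j rfl hj) haa hi
            have hi1 : kd G f w i = 1 ∨ kd G f w i = 4 :=
              h.kd_of_outer hG hi h1.1 haa.symm hj
            rw [Nat.add_sub_cancel_left, testBit_enc (link G f w i),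
              decide_eq_true (mem_link.2 ⟨hi1, hj1, haa.symm⟩)]
            simp

end Hex

end Positions

section Extension

variable {V : Type} {G : SimpleGraph V} {S : Set V}

/-- The graph of the edges of `G` that avoid `S`. -/
def rest (G : SimpleGraph V) (S : Set V) : SimpleGraph V where
  Adj a b := G.Adj a b ∧ a ∉ S ∧ b ∉ S
  symm := ⟨fun _ _ h => ⟨h.1.symm, h.2.2, h.2.1⟩⟩
  loopless := ⟨fun _ h => G.loopless.irrefl _ h.1⟩

lemma rest_le : rest G S ≤ G := fun _ _ h => h.1

lemma notMem_of_mem_edge {e : Sym2 V} (he : e ∈ (rest G S).edgeSet) {v : V} (hv : v ∈ e) :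
    v ∉ S := by
  induction e using Sym2.ind with
  | _ a b =>
    rcases Sym2.mem_iff.1 hv with rfl | rfl
    · exact he.2.1
    · exact he.2.2

lemma mem_rest {e : Sym2 V} (he : e ∈ G.edgeSet) (hS : ¬∃ v ∈ e, v ∈ S) :
    e ∈ (rest G S).edgeSet := by
  induction e using Sym2.ind with
  | _ a b =>
    exact ⟨he, fun h => hS ⟨a, Sym2.mem_mk_left _ _, h⟩, fun h => hS ⟨b, Sym2.mem_mk_right _ _, h⟩⟩

lemma neighborSet_rest {v : V} (hv : v ∉ S) :
    (rest G S).neighborSet v = G.neighborSet v \ S := by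
  ext y
  exact ⟨fun h => ⟨h.1, h.2.2⟩, fun h => ⟨h.1, hv, h.2⟩⟩

lemma subcubic_rest [Finite V] (hG : Subcubic G) : Subcubic (rest G S) := fun v =>
  (Set.ncard_le_ncard (fun _ h => h.1) (Set.toFinite _)).trans (hG v)

lemma exists_goodColoring_rest [Finite V] (hG : MinCounter V G) {a b : V}
    (hab : G.Adj a b) (ha : a ∈ S) :
    ∃ c, GoodColoring (rest G S) c := by
  refine hG.2.2 V (rest G S) (subcubic_rest hG.1) (Nat.add_lt_add_left ?_ _)
  refine Set.ncard_lt_ncard ⟨SimpleGraph.edgeSet_mono rest_le, fun h => ?_⟩ (Set.toFinite _)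
  exact notMem_of_mem_edge (h (show s(a, b) ∈ G.edgeSet from hab)) (Sym2.mem_mk_left _ _) ha

lemma goodColoring_iff {c : Sym2 V → Fin 8} : GoodColoring G c ↔
    (∀ e ∈ G.edgeSet, ∀ e' ∈ G.edgeSet, e ≠ e' → c e = 0 → c e' = 0 →
      ∀ u ∈ e, ∀ v ∈ e', u ≠ v) ∧
    (∀ e ∈ G.edgeSet, ∀ e' ∈ G.edgeSet, e ≠ e' → c e = c e' → c e ≠ 0 →
      ∀ u ∈ e, ∀ v ∈ e', u ≠ v ∧ ¬G.Adj u v) ∧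
    ∀ e ∈ G.edgeSet, c e = 0 → ∀ v ∈ e, (G.neighborSet v).ncard = 3 := by
  constructor
  · rintro ⟨⟨h1, h2⟩, h3⟩
    refine ⟨fun e he e' he' => ?_, fun e he e' he' => ?_, fun e he => ?_⟩
    · induction e using Sym2.ind with
      | _ a b =>
        induction e' using Sym2.ind with
        | _ x y =>
          intro hne h0 h0' u hu v hv
          have := h1 a b x y he he' hne h0 h0'
          rcases Sym2.mem_iff.1 hu with rfl | rfl <;> rcases Sym2.mem_iff.1 hv with rfl | rfl <;>
            tauto
    · induction e using Sym2.ind with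
      | _ a b =>
        induction e' using Sym2.ind with
        | _ x y =>
          intro hne h0 h0' u hu v hv
          have := h2 a b x y he he' hne h0 h0'
          rcases Sym2.mem_iff.1 hu with rfl | rfl <;> rcases Sym2.mem_iff.1 hv with rfl | rfl <;>
            tauto
    · induction e using Sym2.ind with
      | _ a b =>
        intro h0 v hv
        have := h3 a b he h0
        rcases Sym2.mem_iff.1 hv with rfl | rfl
        · exact this.1
        · exact this.2
  · rintro ⟨h1, h2, h3⟩
    refine ⟨⟨fun a b x y hab hxy hne h0 h0' => ?_, fun a b x y hab hxy hne h0 h0' => ?_⟩,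
      fun a b hab h0 => ?_⟩
    · have := h1 _ hab _ hxy hne h0 h0'
      exact ⟨this _ (Sym2.mem_mk_left _ _) _ (Sym2.mem_mk_left _ _),
        this _ (Sym2.mem_mk_left _ _) _ (Sym2.mem_mk_right _ _),
        this _ (Sym2.mem_mk_right _ _) _ (Sym2.mem_mk_left _ _),
        this _ (Sym2.mem_mk_right _ _) _ (Sym2.mem_mk_right _ _)⟩
    · have := h2 _ hab _ hxy hne h0 h0'
      have e1 := this _ (Sym2.mem_mk_left _ _) _ (Sym2.mem_mk_left _ _)
      have e2 := this _ (Sym2.mem_mk_left _ _) _ (Sym2.mem_mk_right _ _)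
      have e3 := this _ (Sym2.mem_mk_right _ _) _ (Sym2.mem_mk_left _ _)
      have e4 := this _ (Sym2.mem_mk_right _ _) _ (Sym2.mem_mk_right _ _)
      exact ⟨⟨e1.1, e2.1, e3.1, e4.1⟩, e1.2, e2.2, e3.2, e4.2⟩
    · exact ⟨h3 _ hab h0 _ (Sym2.mem_mk_left _ _), h3 _ hab h0 _ (Sym2.mem_mk_right _ _)⟩

/-- A good coloring of the edges avoiding `S` extends to `G` by a suitable coloring `γ` of the other
edges. -/
lemma exists_goodColoring_of_rest [Finite V] (hG : Subcubic G) {c γ : Sym2 V → Fin 8}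
    (hc : GoodColoring (rest G S) c)
    (h1 : ∀ e ∈ G.edgeSet, ∀ e' ∈ G.edgeSet, (∃ v ∈ e, v ∈ S) → (∃ v ∈ e', v ∈ S) → e ≠ e' →
      γ e = 0 → γ e' = 0 → ∀ u ∈ e, ∀ v ∈ e', u ≠ v)
    (h2 : ∀ e ∈ G.edgeSet, ∀ e' ∈ G.edgeSet, (∃ v ∈ e, v ∈ S) → (∃ v ∈ e', v ∈ S) → e ≠ e' →
      γ e = γ e' → γ e ≠ 0 → ∀ u ∈ e, ∀ v ∈ e', u ≠ v ∧ ¬G.Adj u v)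
    (h3 : ∀ e ∈ G.edgeSet, (∃ v ∈ e, v ∈ S) → γ e = 0 → ∀ v ∈ e, (G.neighborSet v).ncard = 3)
    (h4 : ∀ e ∈ G.edgeSet, (∃ v ∈ e, v ∈ S) → γ e ≠ 0 → ∀ e' ∈ (rest G S).edgeSet,
      γ e = c e' → ∀ u ∈ e, ∀ v ∈ e', u ≠ v ∧ ¬G.Adj u v) :
    ∃ c, GoodColoring G c := by
  classical
  rw [goodColoring_iff] at hc
  obtain ⟨g1, g2, g3⟩ := hc
  have key : ∀ e ∈ G.edgeSet, (∃ v ∈ e, v ∈ S) → ∀ e' ∈ (rest G S).edgeSet, c e' = 0 →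
      ∀ u ∈ e, ∀ v ∈ e', u ≠ v := by
    rintro e he ⟨x, hx, hxS⟩ e' he' h0 u hu _ hv rfl
    have hux : u ≠ x := fun h => notMem_of_mem_edge he' hv (h ▸ hxS)
    have heq : e = s(u, x) := (Sym2.mem_and_mem_iff hux).1 ⟨hu, hx⟩
    rw [heq] at he
    have hlt : ((rest G S).neighborSet u).ncard < (G.neighborSet u).ncard :=
      Set.ncard_lt_ncard ⟨fun _ h => h.1, fun h => (h he).2.2 hxS⟩ (Set.toFinite _)
    have := g3 e' he' h0 u hv
    have := hG u
    omega
  refine ⟨fun e => if ∃ v ∈ e, v ∈ S then γ e else c e, goodColoring_iff.2 ⟨?_, ?_, ?_⟩⟩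
  · intro e he e' he' hne h0 h0'
    by_cases hs : ∃ v ∈ e, v ∈ S <;> by_cases hs' : ∃ v ∈ e', v ∈ S
    · rw [if_pos hs] at h0
      rw [if_pos hs'] at h0'
      exact h1 e he e' he' hs hs' hne h0 h0'
    · rw [if_neg hs'] at h0'
      exact key e he hs e' (mem_rest he' hs') h0'
    · rw [if_neg hs] at h0
      exact fun u hu v hv => (key e' he' hs' e (mem_rest he hs) h0 v hv u hu).symm
    · rw [if_neg hs] at h0
      rw [if_neg hs'] at h0'
      exact g1 e (mem_rest he hs) e' (mem_rest he' hs') hne h0 h0'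
  · intro e he e' he' hne h0 h0'
    by_cases hs : ∃ v ∈ e, v ∈ S <;> by_cases hs' : ∃ v ∈ e', v ∈ S
    · rw [if_pos hs] at h0 h0'
      rw [if_pos hs'] at h0
      exact h2 e he e' he' hs hs' hne h0 h0'
    · rw [if_pos hs] at h0 h0'
      rw [if_neg hs'] at h0
      exact h4 e he hs h0' e' (mem_rest he' hs') h0
    · rw [if_neg hs] at h0 h0'
      rw [if_pos hs'] at h0
      intro u hu v hv
      have := h4 e' he' hs' (h0 ▸ h0') e (mem_rest he hs) h0.symm v hv u hu
      exact ⟨this.1.symm, fun h => this.2 h.symm⟩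
    · rw [if_neg hs] at h0 h0'
      rw [if_neg hs'] at h0
      intro u hu v hv
      have := g2 e (mem_rest he hs) e' (mem_rest he' hs') hne h0 h0' u hu v hv
      exact ⟨this.1, fun h => this.2 ⟨h, notMem_of_mem_edge (mem_rest he hs) hu,
        notMem_of_mem_edge (mem_rest he' hs') hv⟩⟩
  · intro e he h0 v hv
    by_cases hs : ∃ v ∈ e, v ∈ S
    · rw [if_pos hs] at h0
      exact h3 e he hs h0 v hv
    · rw [if_neg hs] at h0
      have h5 := g3 e (mem_rest he hs) h0 v hv
      have h6 : ((rest G S).neighborSet v).ncard ≤ (G.neighborSet v).ncard :=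
        Set.ncard_le_ncard (fun _ h => h.1) (Set.toFinite _)
      have := hG v
      omega

end Extension

section Lists

variable {V : Type} {G : SimpleGraph V} {f w : Fin 6 → V}

/-- The edges off the cycle that meet or are joined to edge number `k`. -/
def nearby (G : SimpleGraph V) (f w : Fin 6 → V) (k : ℕ) : Set (Sym2 V) :=
  {e | e ∈ (rest G (Set.range f)).edgeSet ∧ ∃ u ∈ edgeAt f w k, ∃ v ∈ e, u = v ∨ G.Adj u v}

open Classical in
/-- The nonzero colors, lowered by one, that `c` leaves available for edge number `k`. -/
noncomputable def avail (G : SimpleGraph V) (f w : Fin 6 → V) (c : Sym2 V → Fin 8) (k : ℕ) :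
    Finset (Fin 7) :=
  Finset.univ.filter fun x => ∀ e ∈ nearby G f w k, c e ≠ x.succ

lemma mem_avail {c : Sym2 V → Fin 8} {k : ℕ} {x : Fin 7} :
    x ∈ avail G f w c k ↔ ∀ e ∈ nearby G f w k, c e ≠ x.succ := by
  simp only [avail, Finset.mem_filter, Finset.mem_univ, true_and]

lemma ncard_incidenceSet (H : SimpleGraph V) (u : V) :
    (H.incidenceSet u).ncard = (H.neighborSet u).ncard := by
  classical
  exact Nat.card_congr (H.incidenceSetEquivNeighborSet u)

lemma seven_le_avail [Finite V] (c : Sym2 V → Fin 8) (k : ℕ) :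
    7 ≤ (avail G f w c k).card + (nearby G f w k).ncard := by
  have h1 : ((avail G f w c k)ᶜ : Finset (Fin 7)).card ≤ (nearby G f w k).ncard := by
    have hex : ∀ x ∈ (avail G f w c k)ᶜ, ∃ e ∈ nearby G f w k, c e = x.succ := by
      intro x hx
      rw [Finset.mem_compl, mem_avail] at hx
      push Not at hx
      exact hx
    have : Nonempty (Sym2 V) := ⟨s(f 0, f 0)⟩
    choose! g hg hgc using hex
    rw [← Set.ncard_coe_finset]
    refine Set.ncard_le_ncard_of_injOn g (fun x hx => hg x hx) (fun x hx y hy hxy => ?_)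
      (Set.toFinite _)
    have := hgc x hx
    rw [hxy, hgc y hy] at this
    exact (Fin.succ_injective _ this).symm
  rw [Finset.card_compl, Fintype.card_fin] at h1
  omega

namespace Hex

lemma ncard_incidence_third [Finite V] (h : Hex G f w) (hG : Subcubic G) (i : Fin 6) :
    ((rest G (Set.range f)).incidenceSet (w i)).ncard ≤ outDeg (kd G f w i) := by
  rw [ncard_incidenceSet]
  by_cases hi : w i ∈ Set.range f
  · have : (rest G (Set.range f)).neighborSet (w i) = ∅ :=
      Set.eq_empty_of_forall_notMem fun y hy => hy.2.1 hi
    rw [this, Set.ncard_empty]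
    exact Nat.zero_le _
  · rw [neighborSet_rest hi]
    exact h.outer_le hG hi

lemma outDeg_le (i : Fin 6) : outDeg (kd G f w i) ≤ 2 := by
  have : ∀ t : Fin 6, outDeg t ≤ 2 := by decide +kernel
  exact this ⟨kd G f w i, Nat.lt_succ_of_le (kd_le i)⟩

lemma size_side (i : Fin 6) : size (sigs G f w) i = 7 - (outDeg (kd G f w i) +
    if cls G f w i = cls G f w (i + 1) then 0 else outDeg (kd G f w (i + 1))) := by
  unfold size
  rw [Nat.ble_eq_true_of_le (by omega), cond_true, succ6_val, entry_sigs, entry_sigs]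
  simp only [natBeq_eq_decide, tagOf_sig, maskOf_sig, enc_injective.eq_iff]
  split_ifs with h <;> simp [h]

lemma size_spoke (i : Fin 6) : size (sigs G f w) (6 + i) =
    if outDeg (kd G f w i) = 0 then 7 else if link G f w i = ∅ then 4 else 6 := by
  unfold size
  rw [ble_spoke, cond_false, sub_spoke, entry_sigs]
  simp only [isZero_eq, tagOf_sig, linkOf_sig, enc_eq_zero]
  split_ifs with h h' <;> simp [*]

/-- A vertex off the cycle joined to `f i` is its third neighbour. -/
lemma mem_incidence (h : Hex G f w) {i : Fin 6} {v : V} {e : Sym2 V}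
    (he : e ∈ (rest G (Set.range f)).edgeSet) (hv : v ∈ e) (hi : f i = v ∨ G.Adj (f i) v) :
    e ∈ (rest G (Set.range f)).incidenceSet (w i) ∧ v = w i := by
  have hvS := notMem_of_mem_edge he hv
  rcases hi with rfl | hi
  · exact absurd ⟨i, rfl⟩ hvS
  · have := h.adj_third hi hvS
    exact ⟨⟨he, this ▸ hv⟩, this⟩

lemma nearby_side (h : Hex G f w) (i : Fin 6) : nearby G f w i ⊆
    (rest G (Set.range f)).incidenceSet (w i) ∪
      (rest G (Set.range f)).incidenceSet (w (i + 1)) := by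
  rintro e ⟨he, u, hu, v, hv, huv⟩
  rw [edgeAt_side, Sym2.mem_iff] at hu
  rcases hu with rfl | rfl
  · exact Or.inl (h.mem_incidence he hv huv).1
  · exact Or.inr (h.mem_incidence he hv huv).1

lemma size_side_add_nearby [Finite V] (h : Hex G f w) (hG : Subcubic G) (i : Fin 6) :
    size (sigs G f w) i + (nearby G f w i).ncard ≤ 7 := by
  have h1 := h.ncard_incidence_third hG i
  have h2 := h.ncard_incidence_third hG (i + 1)
  have h3 := outDeg_le (G := G) (f := f) (w := w) i
  have h4 := outDeg_le (G := G) (f := f) (w := w) (i + 1)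
  have h5 := Set.ncard_le_ncard (h.nearby_side i) (Set.toFinite _)
  rw [size_side]
  split_ifs with hc
  · have hm : i + 1 ∈ cls G f w i := hc ▸ h.mem_cls_self _
    have hr := h.mem_range_iff hm
    by_cases hi : w i ∈ Set.range f
    · have he : ∀ j, w j ∈ Set.range f → (rest G (Set.range f)).incidenceSet (w j) = ∅ :=
        fun j hj => Set.eq_empty_of_forall_notMem fun e he => notMem_of_mem_edge he.1 he.2 hj
      rw [he i hi, he _ (hr.2 hi), Set.union_empty, Set.ncard_empty] at h5
      omega
    · rw [h.third_eq hm hi, Set.union_self] at h5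
      omega
  · have := Set.ncard_union_le ((rest G (Set.range f)).incidenceSet (w i))
      ((rest G (Set.range f)).incidenceSet (w (i + 1)))
    omega

lemma nearby_spoke (h : Hex G f w) {i : Fin 6} {e : Sym2 V}
    (he : e ∈ nearby G f w (6 + i)) : w i ∉ Set.range f ∧ ∃ y, G.Adj (w i) y ∧
      y ∉ Set.range f ∧ e ∈ (rest G (Set.range f)).incidenceSet y := by
  obtain ⟨he, u, hu, v, hv, huv⟩ := he
  have hvS := notMem_of_mem_edge he hv
  have key : v = w i → w i ∉ Set.range f ∧ ∃ y, G.Adj (w i) y ∧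
      y ∉ Set.range f ∧ e ∈ (rest G (Set.range f)).incidenceSet y := by
    rintro rfl
    refine ⟨hvS, ?_⟩
    obtain ⟨y, rfl⟩ := Sym2.mem_iff_exists.1 hv
    exact ⟨y, he.1, he.2.2, he, Sym2.mem_mk_right _ _⟩
  rw [edgeAt_spoke, Sym2.mem_iff] at hu
  rcases hu with rfl | rfl
  · exact key (h.mem_incidence he hv huv).2
  · rcases huv with h1 | h1
    · exact key h1.symm
    · refine ⟨fun ⟨m, hm⟩ => ?_, v, h1, hvS, he, hv⟩
      rw [← hm] at h1
      have := h.adj_third h1 hvS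
      rw [h.chord_symm hm] at this
      exact hvS ⟨i, this.symm⟩

lemma size_spoke_add_nearby [Finite V] (h : Hex G f w) (hG : Subcubic G) {i : Fin 6}
    (h5 : kd G f w i ≠ 5) : size (sigs G f w) (6 + i) + (nearby G f w (6 + i)).ncard ≤ 7 := by
  rcases (nearby G f w (6 + i)).eq_empty_or_nonempty with h0 | ⟨e, he⟩
  · rw [h0, Set.ncard_empty, size_spoke]
    split_ifs <;> omega
  · obtain ⟨hi, y, hy, hyf, -⟩ := h.nearby_spoke he
    have hk := h.kd_of_outer hG hi h5 hy hyf
    have hsub : nearby G f w (6 + i) ⊆ (rest G (Set.range f)).incidenceSet y := by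
      intro e' he'
      obtain ⟨-, z, hz, hzf, hez⟩ := h.nearby_spoke he'
      rwa [h.outer_unique hG hk hy hz hyf hzf]
    have hle := Set.ncard_le_ncard hsub (Set.toFinite _)
    have h1 : outDeg (kd G f w i) = 1 := (outDeg_eq_one_iff i).2 hk
    rw [size_spoke, h1, if_neg one_ne_zero]
    split_ifs with hl
    · rw [ncard_incidenceSet] at hle
      have := subcubic_rest (S := Set.range f) hG y
      omega
    · obtain ⟨j, hj⟩ := Finset.nonempty_iff_ne_empty.2 hl
      obtain ⟨-, hkj, hadj⟩ := mem_link.1 hj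
      have hyj := h.outer_unique hG hk hy hadj hyf (out_of_kd hkj)
      have h2 := h.ncard_incidence_third hG j
      rw [(outDeg_eq_one_iff j).2 hkj, ← hyj] at h2
      omega

lemma size_le_avail [Finite V] (h : Hex G f w) (hG : Subcubic G) (c : Sym2 V → Fin 8) {k : ℕ}
    (hk : k < 12)
    (hp : present (sigs G f w) k = true) : size (sigs G f w) k ≤ (avail G f w c k).card := by
  have h1 := seven_le_avail (G := G) (f := f) (w := w) c k
  have h2 : size (sigs G f w) k + (nearby G f w k).ncard ≤ 7 := by
    obtain ⟨i, rfl | rfl⟩ := side_or_spoke hk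
    · exact h.size_side_add_nearby hG i
    · exact h.size_spoke_add_nearby hG ((present_spoke i).1 hp).1
  omega

end Hex

end Lists

section Reducibility

variable {V : Type} {G : SimpleGraph V} {f w : Fin 6 → V}

lemma add_one_ne_sub_one (i : Fin 6) : i + 1 ≠ i - 1 := by
  revert i
  decide

lemma exists_hex [Finite V] (hG : Subcubic G) (hf : Function.Injective f)
    (ha : ∀ i, G.Adj (f i) (f (i + 1))) : ∃ w, Hex G f w := by
  have ha' : ∀ i, G.Adj (f i) (f (i - 1)) := fun i => by
    have := ha (i - 1)
    rw [sub_add_cancel] at this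
    exact this.symm
  have hex : ∀ i, ∃ u, ((G.Adj (f i) u ∧ u ≠ f (i + 1) ∧ u ≠ f (i - 1)) ∨ u = f i) ∧
      ∀ y, G.Adj (f i) y → y = f (i + 1) ∨ y = f (i - 1) ∨ y = u := by
    intro i
    by_cases h : ∃ u, G.Adj (f i) u ∧ u ≠ f (i + 1) ∧ u ≠ f (i - 1)
    · obtain ⟨u, hu⟩ := h
      refine ⟨u, Or.inl hu, fun y hy => ?_⟩
      by_contra! hn
      have h4 : ({y, u, f (i + 1), f (i - 1)} : Set V).ncard = 4 := by
        rw [Set.ncard_insert_of_notMem (by simp; tauto),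
          Set.ncard_insert_of_notMem (by simp; tauto),
          Set.ncard_pair (hf.ne (add_one_ne_sub_one i))]
      have hsub : ({y, u, f (i + 1), f (i - 1)} : Set V) ⊆ G.neighborSet (f i) := by
        rintro z (rfl | rfl | rfl | rfl)
        · exact hy
        · exact hu.1
        · exact ha i
        · exact ha' i
      have := Set.ncard_le_ncard hsub (Set.toFinite _)
      have := hG (f i)
      omega
    · push Not at h
      refine ⟨f i, Or.inr rfl, fun y hy => ?_⟩
      by_cases h1 : y = f (i + 1)
      · exact Or.inl h1
      · exact Or.inr (Or.inl (h y hy h1))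
  choose w hw hw' using hex
  exact ⟨w, hf, ha, hw', hw⟩

namespace Hex

lemma ncard_neighborSet [Finite V] (h : Hex G f w) (hG : Subcubic G) {i : Fin 6}
    (ha : G.Adj (f i) (w i)) : (G.neighborSet (f i)).ncard = 3 := by
  obtain ⟨-, h1, h2⟩ := (h.third i).resolve_right fun h1 => by
    rw [h1] at ha
    exact G.loopless.irrefl _ ha
  have h3 : ({w i, f (i + 1), f (i - 1)} : Set V).ncard = 3 := by
    rw [Set.ncard_insert_of_notMem (by simp; tauto),
      Set.ncard_pair (h.inj.ne (add_one_ne_sub_one i))]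
  have hsub : ({w i, f (i + 1), f (i - 1)} : Set V) ⊆ G.neighborSet (f i) := by
    rintro z (rfl | rfl | rfl)
    · exact ha
    · exact h.adj i
    · exact h.adj' i
  have := Set.ncard_le_ncard hsub (Set.toFinite _)
  have := hG (f i)
  omega

lemma ncard_neighborSet_third [Finite V] (h : Hex G f w) (hG : Subcubic G) {i : Fin 6}
    (hi : w i ∉ Set.range f) (h0 : kd G f w i ≠ 0) (h4 : kd G f w i ≠ 4) :
    (G.neighborSet (w i)).ncard = 3 := by
  have h1 := h.card_out hG hi
  rw [← h.card_inner hi] at h1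
  rw [← inner_add_outer (w i) (Set.range f)]
  rw [h.kd_out hi] at h0 h4
  split_ifs at h0 h4 <;> omega

lemma zeroOk_spoke {i : Fin 6} (hz : zeroOk (sigs G f w) (6 + i) = true) :
    1 ≤ kd G f w i ∧ kd G f w i ≤ 3 := by
  unfold zeroOk at hz
  rw [ble_spoke, cond_false, sub_spoke, entry_sigs, tagOf_sig] at hz
  cases h4 : Nat.ble 4 (kd G f w i)
  · rw [h4, cond_false] at hz
    refine ⟨Nat.le_of_ble_eq_true hz, ?_⟩
    by_contra hn
    rw [Nat.ble_eq_true_of_le (by omega)] at h4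
    exact Bool.noConfusion h4
  · rw [h4] at hz
    exact Bool.noConfusion hz

lemma testBit_forced (h : Hex G f w) {i : Fin 6} (hi : kd G f w i = 5) :
    (forced (sigs G f w)).testBit i = true := by
  refine forced_testBit (c := sig G f w i) ?_ ((tagOf_sig i).trans hi) ?_
  · fin_cases i <;> simp [sigs]
  · rw [maskOf_sig, testBit_enc]
    exact decide_eq_true (h.mem_cls_self i)

lemma kd_ne_five (h : Hex G f w) {k : ℕ} (hk : k < 12) (hp : present (sigs G f w) k = true)
    {j : Fin 6} (hj : w j ∈ edgeAt f w k) (hjS : w j ∉ Set.range f) : kd G f w j ≠ 5 := by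
  obtain ⟨i, rfl | rfl⟩ := side_or_spoke hk
  · rw [edgeAt_side, Sym2.mem_iff] at hj
    rcases hj with hj | hj
    · exact absurd ⟨_, hj.symm⟩ hjS
    · exact absurd ⟨_, hj.symm⟩ hjS
  · rw [edgeAt_spoke, Sym2.mem_iff] at hj
    rcases hj with hj | hj
    · exact absurd ⟨_, hj.symm⟩ hjS
    · have hi : w i ∉ Set.range f := hj ▸ hjS
      have : j ∈ cls G f w i := (mem_cls_out hi).2 (hj ▸ h.adj_of_out hjS)
      rw [h.kd_eq this]
      exact ((present_spoke i).1 hp).1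

lemma enc_pair_lt {i j : Fin 6} : enc {i, j} < 2 ^ ((i : ℕ) + 1) ↔ j ≤ i := by
  revert i j
  decide +kernel

/-- Every edge meeting the cycle has a number, except the edges from the cycle to a third neighbour
with two neighbours off the cycle. -/
lemma exists_edgeAt (h : Hex G f w) {e : Sym2 V} (he : e ∈ G.edgeSet)
    (hS : ∃ v ∈ e, v ∈ Set.range f) :
    (∃ k < 12, present (sigs G f w) k = true ∧ edgeAt f w k = e) ∨
      ∃ i, kd G f w i = 5 ∧ w i ∉ Set.range f ∧ e = s(f i, w i) := by
  obtain ⟨_, hv, j, rfl⟩ := hS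
  obtain ⟨y, rfl⟩ := Sym2.mem_iff_exists.1 hv
  rcases h.nbr j y he with rfl | rfl | rfl
  · exact Or.inl ⟨j, by omega, present_side j, edgeAt_side j⟩
  · refine Or.inl ⟨(j - 1 : Fin 6), by omega, present_side _, ?_⟩
    rw [edgeAt_side, sub_add_cancel, Sym2.eq_swap]
  · by_cases hj : w j ∈ Set.range f
    · have h3 : kd G f w j = 3 := h.kd_eq_three_iff.2 ⟨he, hj⟩
      obtain ⟨m, hm, hc, -⟩ := h.exists_chord h3
      rcases le_total m j with hle | hle
      · refine Or.inl ⟨6 + j, by omega, (present_spoke j).2 ⟨by omega, fun _ => ?_⟩,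
          edgeAt_spoke j⟩
        rw [hc]
        exact enc_pair_lt.2 hle
      · have hmc : m ∈ cls G f w j := (mem_cls_in hj).2 (Or.inr hm)
        refine Or.inl ⟨6 + m, by omega, (present_spoke m).2 ⟨by rw [h.kd_eq hmc]; omega,
          fun _ => ?_⟩, ?_⟩
        · rw [h.cls_eq hmc, hc, Finset.pair_comm]
          exact enc_pair_lt.2 hle
        · rw [edgeAt_spoke, h.chord_symm hm, hm, Sym2.eq_swap]
    · by_cases h5 : kd G f w j = 5
      · exact Or.inr ⟨j, h5, hj, rfl⟩
      · exact Or.inl ⟨6 + j, by omega, (present_spoke j).2 ⟨h5, fun h3 =>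
          absurd (h.kd_eq_three_iff.1 h3).2 hj⟩, edgeAt_spoke j⟩

/-- A numbered edge that may get color `0` joins vertices of degree `3`. -/
lemma ncard_neighborSet_of_zero [Finite V] (h : Hex G f w) (hG : Subcubic G) {k : ℕ} (hk : k < 12)
    (hp : present (sigs G f w) k = true) (hz : zeroOk (sigs G f w) k = true)
    (hf : ends (sigs G f w) k &&& forced (sigs G f w) = 0) {v : V} (hv : v ∈ edgeAt f w k) :
    (G.neighborSet v).ncard = 3 := by
  have key : ∀ i, f i ∈ edgeAt f w k → (G.neighborSet (f i)).ncard = 3 := by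
    intro i hi
    refine h.ncard_neighborSet hG (h.adj_of_kd fun h5 => ?_)
    exact and_ne_zero_of_testBit (h.testBit_ends hk hp hi (Or.inl ⟨i, rfl, rfl⟩))
      (h.testBit_forced h5) hf
  by_cases hvS : v ∈ Set.range f
  · obtain ⟨i, rfl⟩ := hvS
    exact key i hv
  obtain ⟨i, rfl | rfl⟩ := side_or_spoke hk
  · rw [edgeAt_side, Sym2.mem_iff] at hv
    rcases hv with rfl | rfl
    · exact absurd ⟨_, rfl⟩ hvS
    · exact absurd ⟨_, rfl⟩ hvS
  · rw [edgeAt_spoke, Sym2.mem_iff] at hv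
    have := zeroOk_spoke hz
    rcases hv with rfl | rfl
    · exact absurd ⟨_, rfl⟩ hvS
    · exact h.ncard_neighborSet_third hG hvS (by omega) (by omega)

theorem exists_goodColoring [Finite V] (h : Hex G f w) (hG : MinCounter V G) {order : List ℕ}
    {dp : ℕ} (ho : attempt (sigs G f w) order dp = true) : ∃ c, GoodColoring G c := by
  obtain ⟨c, hc⟩ := exists_goodColoring_rest hG (h.adj 0) (Set.mem_range_self (f := f) 0)
  obtain ⟨Z, hZ, hZZ, hL⟩ := exists_of_attempt ho
  obtain ⟨φ, hφ, hφφ⟩ := hL (avail G f w c) fun k hk hp => h.size_le_avail hG.1 c hk hp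
  have hγ : ∀ e, ∃ x : Fin 8, e ∈ G.edgeSet → (∃ v ∈ e, v ∈ Set.range f) →
      (∃ k < 12, present (sigs G f w) k = true ∧ edgeAt f w k = e ∧
        (Z k ∧ x = 0 ∨ ¬Z k ∧ x = (φ k).succ)) ∨
      ∃ i, kd G f w i = 5 ∧ w i ∉ Set.range f ∧ e = s(f i, w i) ∧ x = 0 := by
    intro e
    by_cases he : e ∈ G.edgeSet ∧ ∃ v ∈ e, v ∈ Set.range f
    · rcases h.exists_edgeAt he.1 he.2 with ⟨k, hk, hp, hke⟩ | ⟨i, h5, hi, hie⟩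
      · by_cases hz : Z k
        · exact ⟨0, fun _ _ => Or.inl ⟨k, hk, hp, hke, Or.inl ⟨hz, rfl⟩⟩⟩
        · exact ⟨_, fun _ _ => Or.inl ⟨k, hk, hp, hke, Or.inr ⟨hz, rfl⟩⟩⟩
      · exact ⟨0, fun _ _ => Or.inr ⟨i, h5, hi, hie, rfl⟩⟩
    · exact ⟨0, fun h1 h2 => absurd ⟨h1, h2⟩ he⟩
  choose γ hγ using hγ
  have hzero : ∀ e ∈ G.edgeSet, (∃ v ∈ e, v ∈ Set.range f) → γ e = 0 →
      (∃ k < 12, present (sigs G f w) k = true ∧ edgeAt f w k = e ∧ Z k) ∨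
      ∃ i, kd G f w i = 5 ∧ w i ∉ Set.range f ∧ e = s(f i, w i) := by
    intro e he hS h0
    rcases hγ e he hS with ⟨k, hk, hp, hke, ⟨hz, -⟩ | ⟨-, hx⟩⟩ | ⟨i, h5, hi, hie, -⟩
    · exact Or.inl ⟨k, hk, hp, hke, hz⟩
    · exact absurd (hx.symm.trans h0) (Fin.succ_ne_zero _)
    · exact Or.inr ⟨i, h5, hi, hie⟩
  have hsucc : ∀ e ∈ G.edgeSet, (∃ v ∈ e, v ∈ Set.range f) → γ e ≠ 0 →
      ∃ k < 12, present (sigs G f w) k = true ∧ edgeAt f w k = e ∧ ¬Z k ∧ γ e = (φ k).succ := by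
    intro e he hS h0
    rcases hγ e he hS with ⟨k, hk, hp, hke, ⟨-, hx⟩ | ⟨hz, hx⟩⟩ | ⟨i, -, -, -, hx⟩
    · exact absurd hx h0
    · exact ⟨k, hk, hp, hke, hz, hx⟩
    · exact absurd hx h0
  have hmixed : ∀ k < 12, present (sigs G f w) k = true → Z k → ∀ i, kd G f w i = 5 →
      w i ∉ Set.range f → ∀ u ∈ edgeAt f w k, u ∉ s(f i, w i) := by
    intro k hk hp hz i h5 hi u hu hu'
    rcases Sym2.mem_iff.1 hu' with rfl | rfl
    · exact and_ne_zero_of_testBit (h.testBit_ends hk hp hu (Or.inl ⟨i, rfl, rfl⟩))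
        (h.testBit_forced h5) (hZ k hz).2
    · exact h.kd_ne_five hk hp hu hi h5
  refine exists_goodColoring_of_rest hG.1 hc (γ := γ) ?_ ?_ ?_ ?_
  · rintro e he e' he' hS hS' hne h0 h0' u hu _ hu' rfl
    rcases hzero e he hS h0 with ⟨k, hk, hp, rfl, hz⟩ | ⟨i, h5, hi, rfl⟩ <;>
      rcases hzero e' he' hS' h0' with ⟨k', hk', hp', rfl, hz'⟩ | ⟨i', h5', hi', rfl⟩
    · obtain ⟨b, hb⟩ := exists_marks hk hu
      exact and_ne_zero_of_testBit (h.testBit_ends hk hp hu hb) (h.testBit_ends hk' hp' hu' hb)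
        (hZZ k k' hz hz' fun hkk => hne (by rw [hkk]))
    · exact hmixed k hk hp hz i' h5' hi' u hu hu'
    · exact hmixed k' hk' hp' hz' i h5 hi u hu' hu
    · have hii : i = i' := by
        rcases Sym2.mem_iff.1 hu with rfl | rfl <;> rcases Sym2.mem_iff.1 hu' with h1 | h1
        · exact h.inj h1
        · exact absurd ⟨_, h1⟩ hi'
        · exact absurd ⟨_, h1.symm⟩ hi
        · have h1c : (cls G f w i).card ≤ 1 := by
            rw [h.card_cls hG.1, h5]
            exact le_refl 1
          exact Finset.card_le_one.1 h1c _ (h.mem_cls_self i) _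
            ((mem_cls_out hi).2 (h1 ▸ h.adj_of_out hi'))
      exact hne (by rw [hii])
  · intro e he e' he' hS hS' hne heq h0 u hu v hv
    obtain ⟨k, hk, hp, rfl, hz, hx⟩ := hsucc e he hS h0
    obtain ⟨k', hk', hp', rfl, hz', hx'⟩ := hsucc e' he' hS' (heq ▸ h0)
    obtain ⟨b, hb⟩ := exists_marks hk hu
    by_contra hn
    refine hφφ k hk k' hk' hp hp' hz hz' (fun hkk => hne (by rw [hkk])) ?_
      (Fin.succ_injective _ (hx.symm.trans (heq.trans hx')))
    refine and_ne_zero_of_testBit (h.testBit_ends hk hp hu hb)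
      (h.testBit_hood hG.1 hk' hp' hv hb (by tauto) ?_)
    rintro j rfl hj
    exact h.kd_ne_five hk hp hu hj
  · intro e he hS h0 v hv
    rcases hzero e he hS h0 with ⟨k, hk, hp, rfl, hz⟩ | ⟨i, h5, hi, rfl⟩
    · exact h.ncard_neighborSet_of_zero hG.1 hk hp (hZ k hz).1 (hZ k hz).2 hv
    · rcases Sym2.mem_iff.1 hv with rfl | rfl
      · exact h.ncard_neighborSet hG.1 (h.adj_of_out hi)
      · exact h.ncard_neighborSet_third hG.1 hi (by omega) (by omega)
  · intro e he hS h0 e' he' heq u hu v hv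
    obtain ⟨k, hk, hp, rfl, hz, hx⟩ := hsucc e he hS h0
    by_contra hn
    exact mem_avail.1 (hφ k hk hp hz) e' ⟨he', u, hu, v, hv, by tauto⟩ (heq.symm.trans hx)

end Hex

/-- A minimal counterexample has no `6`-cycle, provided the search over all local structures around
a `6`-cycle succeeds. -/
theorem MinCounter.not_hex [Finite V] (hG : MinCounter V G)
    (hc : ∀ t ≤ 5, colorableAll t = true) (h : Hex G f w) : False := by
  obtain ⟨⟨f', w'⟩, h', hmax⟩ := Set.exists_max_image
    {p : (Fin 6 → V) × (Fin 6 → V) | Hex G p.1 p.2} (fun p => rk G p.1 p.2) (Set.toFinite _)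
    ⟨(f, w), h⟩
  obtain ⟨order, dp, ho⟩ := exists_attempt hc h' hG.1 (fun j => hmax (_, _) (h'.shift j))
    fun j => hmax (_, _) (h'.reflect j)
  exact hG.2.1 (h'.exists_goodColoring hG ho)

lemma exists_hex_of_isCycle [Finite V] (hG : Subcubic G) {v : V} {p : G.Walk v v}
    (hp : p.IsCycle) (hl : p.length = 6) : ∃ f w, Hex G f w := by
  have hinj : Function.Injective fun i : Fin 6 => p.getVert i := by
    intro i j hij
    have := hp.getVert_injOn' (show (i : ℕ) ∈ _ from ?_) (show (j : ℕ) ∈ _ from ?_) hij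
    · exact Fin.ext this
    · simp only [Set.mem_ofPred_eq]; omega
    · simp only [Set.mem_ofPred_eq]; omega
  refine ⟨fun i => p.getVert i, exists_hex hG hinj fun i => ?_⟩
  have h1 := p.adj_getVert_succ (i := i) (by omega)
  have h6 : p.getVert 6 = p.getVert 0 := by
    rw [← hl, Walk.getVert_length, Walk.getVert_zero]
  fin_cases i
  · exact h1
  · exact h1
  · exact h1
  · exact h1
  · exact h1
  · exact h6 ▸ h1

end Reducibility

section Evaluation

set_option maxRecDepth 100000 in
lemma colorableAll_zero : colorableAll 0 = true := by
  decide +kernel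

set_option maxRecDepth 100000 in
lemma colorableAll_one : colorableAll 1 = true := by
  decide +kernel

set_option maxRecDepth 100000 in
lemma colorableAll_two : colorableAll 2 = true := by
  decide +kernel

set_option maxRecDepth 100000 in
lemma colorableAll_three : colorableAll 3 = true := by
  decide +kernel

set_option maxRecDepth 100000 in
lemma colorableAll_four : colorableAll 4 = true := by
  decide +kernel

set_option maxRecDepth 100000 in
lemma colorableAll_five : colorableAll 5 = true := by
  decide +kernel

lemma colorableAll_of_le_five : ∀ t ≤ 5, colorableAll t = true := by
  intro t ht
  interval_cases t
  exacts [colorableAll_zero, colorableAll_one, colorableAll_two, colorableAll_three,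
    colorableAll_four, colorableAll_five]

end Evaluation

/-- A minimal counterexample contains no cycle of length 6. -/
theorem minCounter_no_C6 {V : Type} [Finite V] (G : SimpleGraph V)
    (hG : MinCounter V G) :
    ∀ (v : V) (w : G.Walk v v), w.IsCycle → w.length ≠ 6 := by
  intro v p hp hl
  obtain ⟨f, w, h⟩ := exists_hex_of_isCycle hG.1 hp hl
  exact MinCounter.not_hex hG colorableAll_of_le_five h
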